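/- Let q = p^n with p prime, where one of the following holds: (i) p = 2 and n is prime; (ii) p = 3 and n is an odd prime; (iii) n = 1 and q is a prime with q ≡ ±3 (mod 8) and q > 17; (iv) q ∈ {7, 17}; (v) n = 1 and q is a prime with q ≡ ±1 (mod 8) such that q − 1 or q + 1 is a power of 2. Let G = PSL(2, F_q). If H and K are pronormal subgroups of G, then the subgroup ⟨H, K⟩ generated by H and K (the join H ⊔ K) is pronormal in G. That is, the family of pronormal subgroups of G is closed under joins. -/

import Mathlib

/-- The conjugate `H^g := g⁻¹ H g` of a subgroup `H` by an element `g`. -/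
def Subgroup.conjugate {G : Type*} [Group G] (H : Subgroup G) (g : G) : Subgroup G :=
  H.map (MulAut.conj g⁻¹).toMonoidHom

/-- A subgroup `H` of a group `G` is pronormal in `G` if for every `g ∈ G` there exists
`x ∈ ⟨H, H^g⟩` such that `H^x = H^g`. -/
def IsPronormal {G : Type*} [Group G] (H : Subgroup G) : Prop :=
  ∀ g : G, ∃ x ∈ (H ⊔ H.conjugate g : Subgroup G), H.conjugate x = H.conjugate g

/-! ### Conjugation basics -/

section basics
variable {G : Type*} [Group G]

theorem mem_conjugate {H : Subgroup G} {g y : G} : y ∈ H.conjugate g ↔ g * y * g⁻¹ ∈ H := by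
  constructor
  · rintro ⟨x, hx, rfl⟩
    simpa [mul_assoc] using hx
  · intro h
    exact ⟨_, h, by simp [mul_assoc]⟩

theorem conjugate_mul (H : Subgroup G) (g h : G) :
    H.conjugate (g * h) = (H.conjugate g).conjugate h := by
  ext y; simp [mem_conjugate, mul_assoc]

theorem conjugate_one (H : Subgroup G) : H.conjugate 1 = H := by
  ext y; simp [mem_conjugate]

theorem card_conjugate (H : Subgroup G) (g : G) :
    Nat.card (H.conjugate g) = Nat.card H := by
  unfold Subgroup.conjugate
  exact (Nat.card_congr (H.equivMapOfInjective _ (MulAut.conj g⁻¹).injective).toEquiv).symm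

theorem conjugate_mono {H K : Subgroup G} (h : H ≤ K) (g : G) : H.conjugate g ≤ K.conjugate g := by
  intro y hy; rw [mem_conjugate] at *; exact h hy

theorem conjugate_of_mem {H : Subgroup G} {g : G} (h : g ∈ H) : H.conjugate g = H := by
  ext y; rw [mem_conjugate]
  constructor
  · intro hy
    have := H.mul_mem (H.mul_mem (H.inv_mem h) hy) h
    simpa [mul_assoc] using this
  · intro hy
    exact H.mul_mem (H.mul_mem h hy) (H.inv_mem h)

theorem conjugate_eq_of_subset [Finite G] {H : Subgroup G} {g : G}
    (h : ∀ y ∈ H, g * y * g⁻¹ ∈ H) : H.conjugate g = H := by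
  symm
  apply Subgroup.eq_of_le_of_card_ge
  · intro y hy; rw [mem_conjugate]; exact h y hy
  · rw [card_conjugate]

theorem conjugate_le_of_mem {H L : Subgroup G} {g : G} (hg : g ∈ L) (h : H ≤ L) :
    H.conjugate g ≤ L := by
  have := conjugate_mono h g
  rwa [conjugate_of_mem hg] at this

theorem conjugate_inv_eq {H K : Subgroup G} {g : G} (h : H.conjugate g = K) :
    K.conjugate g⁻¹ = H := by
  rw [← h, ← conjugate_mul, mul_inv_cancel, conjugate_one]

theorem isPronormal_bot : IsPronormal (⊥ : Subgroup G) := by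
  intro g
  refine ⟨1, Subgroup.one_mem _, ?_⟩
  ext y; simp [mem_conjugate, Subgroup.mem_bot]

theorem isPronormal_top : IsPronormal (⊤ : Subgroup G) := by
  intro g
  exact ⟨g, by simp, rfl⟩

/-- Reduction: if `C ≤ J` is pronormal, it is enough to test pronormality of `J` on
elements normalizing `C`. -/
theorem pronormal_of_sub {C J : Subgroup G} (hC : IsPronormal C) (hCJ : C ≤ J)
    (h : ∀ g : G, C.conjugate g = C → ∃ x ∈ (J ⊔ J.conjugate g : Subgroup G),
      J.conjugate x = J.conjugate g) : IsPronormal J := by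
  intro g
  obtain ⟨w, hw, hwe⟩ := hC g
  have hwL : w ∈ J ⊔ J.conjugate g := (sup_le_sup hCJ (conjugate_mono hCJ g)) hw
  have h1 : C.conjugate (g * w⁻¹) = C := by
    rw [conjugate_mul, ← hwe, ← conjugate_mul, mul_inv_cancel, conjugate_one]
  obtain ⟨x, hx, hxe⟩ := h _ h1
  have hle : J ⊔ J.conjugate (g * w⁻¹) ≤ J ⊔ J.conjugate g := by
    refine sup_le le_sup_left ?_
    rw [conjugate_mul]
    exact conjugate_le_of_mem (Subgroup.inv_mem _ hwL) le_sup_right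
  refine ⟨x * w, Subgroup.mul_mem _ (hle hx) hwL, ?_⟩
  rw [conjugate_mul, hxe, conjugate_mul, ← conjugate_mul _ w⁻¹ w, inv_mul_cancel, conjugate_one]

/-- Sylow conjugacy inside a subgroup. -/
theorem sylow_conj [Finite G] {r : ℕ} [Fact r.Prime] {P Q L : Subgroup G} (hP : IsPGroup r P)
    (hQ : IsPGroup r Q) (hPL : P ≤ L) (hQL : Q ≤ L) :
    ∃ x ∈ L, ∃ R : Subgroup G, R ≤ L ∧ IsPGroup r R ∧ P.conjugate x ≤ R ∧ Q ≤ R := by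
  have hP' : IsPGroup r (P.subgroupOf L) := hP.comap_of_injective L.subtype L.subtype_injective
  have hQ' : IsPGroup r (Q.subgroupOf L) := hQ.comap_of_injective L.subtype L.subtype_injective
  obtain ⟨S, hS⟩ := hP'.exists_le_sylow
  obtain ⟨T, hT⟩ := hQ'.exists_le_sylow
  obtain ⟨g, hg⟩ := MulAction.exists_smul_eq L S T
  refine ⟨(g⁻¹ : L), (g⁻¹).2, (T : Subgroup L).map L.subtype, ?_, T.isPGroup'.map _, ?_, ?_⟩
  · exact Subgroup.map_subtype_le _
  · intro y hy
    rw [mem_conjugate] at hy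
    have hyL : y ∈ L := by
      have := L.mul_mem (L.mul_mem g.2 (hPL hy)) (g⁻¹).2
      simpa [mul_assoc] using this
    refine ⟨⟨y, hyL⟩, ?_, rfl⟩
    have h1 : g⁻¹ * ⟨y, hyL⟩ * g ∈ (S : Subgroup L) := by
      apply hS
      rw [Subgroup.mem_subgroupOf]
      simpa using hy
    rw [← hg]
    change _ ∈ ((g • S : Sylow r L) : Subgroup L)
    rw [Sylow.coe_subgroup_smul]
    rw [Subgroup.mem_pointwise_smul_iff_inv_smul_mem]
    simpa [MulAut.smul_def] using h1
  · intro y hy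
    exact ⟨⟨y, hQL hy⟩, hT (by rw [Subgroup.mem_subgroupOf]; exact hy), rfl⟩

theorem cyclic_unique [Finite G] {A H K : Subgroup G} (hA : IsCyclic A) (hH : H ≤ A) (hK : K ≤ A)
    (hc : Nat.card H = Nat.card K) : H = K := by
  classical
  have key : ∀ M : Subgroup G, M ≤ A → Nat.card M = Nat.card H →
      (M.subgroupOf A : Set A) = {a : A | a ^ Nat.card H = 1} := by
    intro M hM hMc
    have : Fintype A := Fintype.ofFinite A
    have h1 : (M.subgroupOf A : Set A) ⊆ {a : A | a ^ Nat.card H = 1} := by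
      intro a ha
      have h2 : (⟨a.1, ha⟩ : M) ^ Nat.card M = 1 := pow_card_eq_one'
      rw [hMc] at h2
      have := congrArg Subtype.val h2
      apply Subtype.ext
      simpa using this
    apply Set.eq_of_subset_of_ncard_le h1
    have h3 := IsCyclic.card_pow_eq_one_le (α := A) (n := Nat.card H) Nat.card_pos
    have h4 : {a : A | a ^ Nat.card H = 1}.ncard ≤ Nat.card H := by
      rw [Set.ncard_eq_toFinset_card']
      convert h3 using 2
      ext; simp
    refine h4.trans ?_
    rw [← hMc, ← Nat.card_coe_set_eq]
    exact le_of_eq (Nat.card_congr (Subgroup.subgroupOfEquivOfLe hM).toEquiv).symm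
  have := (key H hH rfl).trans (key K hK hc.symm).symm
  have h5 : H.subgroupOf A = K.subgroupOf A := SetLike.coe_injective this
  have := Subgroup.subgroupOf_inj.mp h5
  rwa [inf_eq_left.mpr hH, inf_eq_left.mpr hK] at this

end basics

/-- The abstract properties of the partition of `PSL(2,q)` used in the proof: `A x` is the image of
the centralizer of a lift of `x`, and `S x` says that `x` is semisimple. -/
structure PartData (G : Type*) [Group G] where
  A : G → Subgroup G
  S : G → Prop
  mem_self : ∀ x, x ∈ A x
  A_eq : ∀ {x y}, x ≠ 1 → y ∈ A x → y ≠ 1 → A y = A x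
  A_conj : ∀ {x y} (g), y ∈ A x → g * y * g⁻¹ ∈ A (g * x * g⁻¹)
  A_comm : ∀ {x y z}, x ≠ 1 → y ∈ A x → z ∈ A x → y * z = z * y
  S_of_mem : ∀ {x y}, x ≠ 1 → S x → y ∈ A x → y ≠ 1 → S y
  S_conj : ∀ {x} (g), S x → S (g * x * g⁻¹)
  S_cyc : ∀ {x}, x ≠ 1 → S x → IsCyclic (A x)
  S_inv : ∀ {x g}, x ≠ 1 → S x → g * x * g⁻¹ ∈ A x → g ∉ A x →
    (∀ y ∈ A x, g * y * g⁻¹ = y⁻¹) ∧ g * g = 1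
  S_mul : ∀ {x g h}, x ≠ 1 → S x → g * x * g⁻¹ ∈ A x → g ∉ A x → h * x * h⁻¹ ∈ A x → h ∉ A x →
    g * h ∈ A x
  S_card : ∀ {x}, x ≠ 1 → S x → ¬ 4 ∣ Nat.card (A x) ∨ ∃ k, Nat.card (A x) = 2 ^ k
  S_sqrt : ∀ {z w y}, z ≠ 1 → w ≠ 1 → z * z = 1 → w * w = 1 → S z → S w → y ∈ A z → y * y = z →
    ∃ y' ∈ A w, y' * y' = w
  U_simple : ∀ {u}, u ≠ 1 → ¬ S u → ∀ H ≤ A u, (∀ g, g * u * g⁻¹ ∈ A u → ∀ h ∈ H, g * h * g⁻¹ ∈ H) →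
    H = ⊥ ∨ H = A u
  U_comm : ∀ {u g h}, u ≠ 1 → ¬ S u → g * u * g⁻¹ ∈ A u → h * u * h⁻¹ ∈ A u →
    g * h * g⁻¹ * h⁻¹ ∈ A u
  U_full : ∀ {u g} (J : Subgroup G), u ≠ 1 → ¬ S u → u ∈ J → g ∈ J → g * u * g⁻¹ ∈ A u → g ∉ A u →
    A u ≤ J
  U_gen : ∀ {u v} (L : Subgroup G), u ≠ 1 → ¬ S u → v ≠ 1 → ¬ S v → A u ≠ A v → A u ≤ L → A v ≤ L →
    L = ⊤
  U_cent : ∀ {u g}, u ≠ 1 → ¬ S u → g * u = u * g → g ∈ A u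

namespace PartData
variable {G : Type*} [Group G] (D : PartData G)

theorem conj_ne_one {x : G} (g : G) (h : x ≠ 1) : g * x * g⁻¹ ≠ 1 := by
  intro h'
  exact h (conj_eq_one_iff.mp h')

/-- The normalizer of `A x`. -/
def N (x : G) (hx : x ≠ 1) : Subgroup G where
  carrier := {g | D.A (g * x * g⁻¹) = D.A x}
  one_mem' := by simp
  mul_mem' := by
    intro a b ha hb
    simp only [Set.mem_ofPred_eq] at *
    have h1 : b * x * b⁻¹ ∈ D.A x := hb ▸ D.mem_self _
    have h2 := D.A_conj a h1
    have h3 := D.A_eq (conj_ne_one a hx) h2 (conj_ne_one a (conj_ne_one b hx))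
    rw [← ha, ← h3]; congr 1; group
  inv_mem' := by
    intro a ha
    simp only [Set.mem_ofPred_eq] at *
    have h1 : x ∈ D.A (a * x * a⁻¹) := ha ▸ D.mem_self _
    have h2 := D.A_conj a⁻¹ h1
    have h3 : a⁻¹ * (a * x * a⁻¹) * a⁻¹⁻¹ = x := by group
    rw [h3] at h2
    exact D.A_eq hx h2 (conj_ne_one _ hx)

variable {D}

theorem mem_N {x g : G} (hx : x ≠ 1) : g ∈ D.N x hx ↔ g * x * g⁻¹ ∈ D.A x :=
  ⟨fun h => (show D.A (g * x * g⁻¹) = D.A x from h) ▸ D.mem_self _,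
   fun h => D.A_eq hx h (conj_ne_one g hx)⟩

theorem A_le_N {x : G} (hx : x ≠ 1) : D.A x ≤ D.N x hx := by
  intro g hg
  rw [mem_N]
  exact (D.A x).mul_mem ((D.A x).mul_mem hg (D.mem_self x)) ((D.A x).inv_mem hg)

theorem conj_mem_of_N {x g y : G} (hx : x ≠ 1) (hg : g ∈ D.N x hx) (hy : y ∈ D.A x) :
    g * y * g⁻¹ ∈ D.A x := by
  have h : D.A (g * x * g⁻¹) = D.A x := hg
  rw [← h]; exact D.A_conj g hy

theorem mem_N_of_conj {x g y : G} (hx : x ≠ 1) (hy : y ∈ D.A x) (hy1 : y ≠ 1)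
    (h : g * y * g⁻¹ ∈ D.A x) : g ∈ D.N x hx := by
  have e := D.A_eq hx hy hy1
  have h1 : g ∈ D.N y hy1 := by rw [mem_N, e]; exact h
  have hxy : x ∈ D.A y := e ▸ D.mem_self x
  rw [mem_N]
  have := conj_mem_of_N hy1 h1 hxy
  rwa [e] at this

theorem mem_N_of_comm {x g : G} (hx : x ≠ 1) (h : g * x = x * g) : g ∈ D.N x hx := by
  rw [mem_N, h, mul_assoc, mul_inv_cancel, mul_one]; exact D.mem_self x

theorem index_two {x : G} (hx : x ≠ 1) (hS : D.S x) {J : Subgroup G} (hJ : J ≤ D.N x hx) {t : G}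
    (ht : t ∈ J) (htA : t ∉ D.A x) (j : G) (hj : j ∈ J) : j ∈ D.A x ∨ t * j ∈ D.A x := by
  by_cases h : j ∈ D.A x
  · exact Or.inl h
  · exact Or.inr (D.S_mul hx hS ((mem_N hx).mp (hJ ht)) htA ((mem_N hx).mp (hJ hj)) h)

theorem card_index_two [Finite G] {x : G} (hx : x ≠ 1) (hS : D.S x) {J : Subgroup G}
    (hJ : J ≤ D.N x hx) {t : G}
    (ht : t ∈ J) (htA : t ∉ D.A x) : Nat.card J = 2 * Nat.card (J ⊓ D.A x : Subgroup G) := by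
  have h1 : (J ⊓ D.A x).relIndex J = 2 := by
    rw [Subgroup.relIndex, Subgroup.index_eq_two_iff]
    refine ⟨⟨t, ht⟩, ?_⟩
    rintro ⟨b, hb⟩
    simp only [Subgroup.mem_subgroupOf, Subgroup.coe_mul, Subgroup.mem_inf]
    have h2 : b * t ∈ J := J.mul_mem hb ht
    by_cases h : b ∈ D.A x
    · refine Or.inr ⟨⟨hb, h⟩, fun h' => htA ?_⟩
      have := (D.A x).mul_mem ((D.A x).inv_mem h) h'.2
      simpa using this
    · refine Or.inl ⟨⟨h2, D.S_mul hx hS ((mem_N hx).mp (hJ hb)) h ((mem_N hx).mp (hJ ht)) htA⟩,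
        fun h' => h h'.2⟩
  have h2 := Subgroup.card_mul_index ((J ⊓ D.A x).subgroupOf J)
  have h3 : Nat.card ((J ⊓ D.A x).subgroupOf J) = Nat.card (J ⊓ D.A x : Subgroup G) :=
    Nat.card_congr (Subgroup.subgroupOfEquivOfLe inf_le_left).toEquiv
  rw [Subgroup.relIndex] at h1
  rw [h1, h3] at h2
  omega

/-- Elements of order bigger than two in an abelian situation. -/
theorem A_eq_of_comm {y z : G} (hy : y * y ≠ 1) (hS : D.S y) (hz : z ≠ 1) (hc : z * y = y * z) :
    D.A z = D.A y := by
  have hy1 : y ≠ 1 := by rintro rfl; simp at hy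
  by_cases h : z ∈ D.A y
  · exact D.A_eq hy1 h hz
  · exfalso
    have h1 := (D.S_inv hy1 hS ((mem_N hy1).mp (mem_N_of_comm hy1 hc)) h).1 y (D.mem_self y)
    rw [hc, mul_assoc, mul_inv_cancel, mul_one] at h1
    apply hy
    nth_rewrite 2 [h1]
    simp

theorem exists_central [Finite G] {r : ℕ} [Fact r.Prime] {R : Subgroup G} (hR : IsPGroup r R)
    (hne : R ≠ ⊥) : ∃ z ∈ R, z ≠ 1 ∧ ∀ y ∈ R, z * y = y * z := by
  have : Nontrivial R := (Subgroup.nontrivial_iff_ne_bot R).mpr hne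
  have := hR.center_nontrivial
  obtain ⟨z, hz⟩ := exists_ne (1 : Subgroup.center R)
  refine ⟨z.1.1, z.1.2, ?_, ?_⟩
  · intro h; apply hz; ext; simpa using h
  · intro y hy
    have := Subgroup.mem_center_iff.mp z.2 ⟨y, hy⟩
    exact (congrArg Subtype.val this).symm

theorem exists_ppow {J : Subgroup G} [Finite G] (hJ : 2 < Nat.card J) (hc : IsCyclic J) :
    ∃ r : ℕ, r.Prime ∧ ∃ y ∈ J, y * y ≠ 1 ∧ IsPGroup r (Subgroup.zpowers y) := by
  by_cases h : ∃ r : ℕ, r.Prime ∧ r ∣ Nat.card J ∧ r ≠ 2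
  · obtain ⟨r, hr, hrd, hr2⟩ := h
    have : Fact r.Prime := ⟨hr⟩
    obtain ⟨y, hy⟩ := exists_prime_orderOf_dvd_card' (G := J) r hrd
    refine ⟨r, hr, y, y.2, ?_, ?_⟩
    · intro h
      have h1 : y ^ 2 = 1 := by rw [pow_two]; ext; simpa using h
      have := orderOf_dvd_of_pow_eq_one h1
      rw [hy] at this
      exact hr2 ((Nat.prime_dvd_prime_iff_eq hr Nat.prime_two).mp this)
    · apply IsPGroup.of_card (n := 1)
      rw [Nat.card_zpowers, Subgroup.orderOf_coe, hy, pow_one]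
  · push Not at h
    have h2 : ∃ k, Nat.card J = 2 ^ k :=
      ⟨_, Nat.eq_prime_pow_of_unique_prime_dvd (by positivity) (fun {d} hd hdd => h d hd hdd)⟩
    obtain ⟨k, hk⟩ := h2
    obtain ⟨y, hy⟩ := IsCyclic.exists_ofOrder_eq_natCard (α := J)
    refine ⟨2, Nat.prime_two, y, y.2, ?_, ?_⟩
    · intro h
      have h1 : y ^ 2 = 1 := by rw [pow_two]; ext; simpa using h
      have := Nat.le_of_dvd (by norm_num) (orderOf_dvd_of_pow_eq_one h1)
      omega
    · apply IsPGroup.of_card (n := k)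
      rw [Nat.card_zpowers, Subgroup.orderOf_coe, hy, hk]

theorem cyclic_of_le [Finite G] {x : G} (hx : x ≠ 1) (hS : D.S x) {J : Subgroup G}
    (hJ : J ≤ D.A x) : IsCyclic J := by
  have := D.S_cyc hx hS
  exact isCyclic_of_injective (Subgroup.inclusion hJ) (Subgroup.inclusion_injective hJ)

/-- Cyclic semisimple subgroups of order bigger than two are pronormal. -/
theorem pronormal_cyclic [Finite G] {x : G} (hx : x ≠ 1) (hS : D.S x) {J : Subgroup G}
    (hJ : J ≤ D.A x) (hc : 2 < Nat.card J) : IsPronormal J := by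
  intro g
  obtain ⟨r, hr, y, hyJ, hyy, hyp⟩ := exists_ppow hc (cyclic_of_le hx hS hJ)
  have : Fact r.Prime := ⟨hr⟩
  have hy1 : y ≠ 1 := by rintro rfl; simp at hyy
  have hSy := D.S_of_mem hx hS (hJ hyJ) hy1
  have hAy := D.A_eq hx (hJ hyJ) hy1
  have hz1 : Subgroup.zpowers y ≤ J := by simpa using hyJ
  have hyp2 : IsPGroup r ((Subgroup.zpowers y).conjugate g) := hyp.map _
  obtain ⟨w, hw, R, -, hRp, hR1, hR2⟩ := sylow_conj hyp hyp2
    (L := J ⊔ J.conjugate g) (hz1.trans le_sup_left) ((conjugate_mono hz1 g).trans le_sup_right)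
  refine ⟨w, hw, ?_⟩
  -- general fact
  have key : ∀ v : G, (Subgroup.zpowers y).conjugate v ≤ R → ∀ z ∈ R, z ≠ 1 →
      (∀ y ∈ R, z * y = y * z) → J.conjugate v ≤ D.A z := by
    intro v hv z hzR hz hzc
    have hm : v⁻¹ * y * v⁻¹⁻¹ ∈ R := by
      apply hv; rw [mem_conjugate]; simp [mul_assoc]
    have h2 : D.A z = D.A (v⁻¹ * y * v⁻¹⁻¹) := by
      apply A_eq_of_comm _ (D.S_conj _ hSy) hz (hzc _ hm)
      have : v⁻¹ * y * v⁻¹⁻¹ * (v⁻¹ * y * v⁻¹⁻¹) = v⁻¹ * (y * y) * v⁻¹⁻¹ := by group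
      rw [this]; exact conj_ne_one _ hyy
    intro j hj
    rw [mem_conjugate] at hj
    have h3 := D.A_conj v⁻¹ (show v * j * v⁻¹ ∈ D.A y from hAy ▸ hJ hj)
    rw [h2]
    have h4 : v⁻¹ * (v * j * v⁻¹) * v⁻¹⁻¹ = j := by group
    rwa [h4] at h3
  have hRne : R ≠ ⊥ := by
    rintro rfl
    have hm : g⁻¹ * y * g⁻¹⁻¹ ∈ (⊥ : Subgroup G) := by
      apply hR2; rw [mem_conjugate]; simp [mul_assoc]
    exact conj_ne_one _ hy1 (Subgroup.mem_bot.mp hm)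
  obtain ⟨z, hzR, hz, hzc⟩ := exists_central hRp hRne
  have hSz : D.S z := by
    have hm : g⁻¹ * y * g⁻¹⁻¹ ∈ R := by
      apply hR2; rw [mem_conjugate]; simp [mul_assoc]
    have h2 : D.A z = D.A (g⁻¹ * y * g⁻¹⁻¹) := by
      apply A_eq_of_comm _ (D.S_conj _ hSy) hz (hzc _ hm)
      have : g⁻¹ * y * g⁻¹⁻¹ * (g⁻¹ * y * g⁻¹⁻¹) = g⁻¹ * (y * y) * g⁻¹⁻¹ := by group
      rw [this]; exact conj_ne_one _ hyy
    exact D.S_of_mem (conj_ne_one _ hy1) (D.S_conj _ hSy) (h2 ▸ D.mem_self z) hz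
  refine cyclic_unique (D.S_cyc hz hSz) (key w hR1 z hzR hz hzc) (key g hR2 z hzR hz hzc) ?_
  rw [card_conjugate, card_conjugate]

/-- Conjugating a reflection by a rotation. -/
theorem refl_conj {x : G} (hx : x ≠ 1) (hS : D.S x) {t : G} (ht : t ∈ D.N x hx) (htA : t ∉ D.A x)
    {g : G} (hg : g ∈ D.A x) : g⁻¹ * t * g = t * (g * g) := by
  have h1 := (D.S_inv hx hS ((mem_N hx).mp ht) htA).1 g hg
  rw [mul_inv_eq_iff_eq_mul] at h1
  rw [← h1]; group
  

/-- Non-pronormality of reflection groups with too small rotation part. -/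
theorem not_pronormal_refl {x : G} (hx : x ≠ 1) (hS : D.S x) {H : Subgroup G}
    (hH : H ≤ D.N x hx) {t : G} (ht : t ∈ H) (htA : t ∉ D.A x) {g : G} (hg : g ∈ D.A x)
    (hg2 : g * g ∉ H) (hg4 : (g * g) * (g * g) ∈ H) : ¬ IsPronormal H := by
  intro hpro
  obtain ⟨w, hw, hwe⟩ := hpro g
  have tt : t * t = 1 := (D.S_inv hx hS ((mem_N hx).mp (hH ht)) htA).2
  have hcomm : ∀ {a b}, a ∈ D.A x → b ∈ D.A x → a * b = b * a := fun ha hb => D.A_comm hx ha hb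
  have hAN := A_le_N (D := D) hx
  have hNw : w ∈ D.N x hx := by
    have : H ⊔ H.conjugate g ≤ D.N x hx := sup_le hH (conjugate_le_of_mem (hAN hg) hH)
    exact this hw
  -- elements of the join square (in A) into H
  have key : ∀ v ∈ H ⊔ H.conjugate g, v ∈ D.A x → v ∈ H ∨ v * (g * g) ∈ H := by
    have hinv : ∀ a ∈ D.A x, a * t = t * a⁻¹ := by
      intro a ha
      have h1 := (D.S_inv hx hS ((mem_N hx).mp (hH ht)) htA).1 a ha
      have tinv : t⁻¹ = t := inv_eq_of_mul_eq_one_left tt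
      rw [← h1, tinv, mul_assoc, ← mul_assoc t t, tt, one_mul]
    have hgg : g * g ∈ D.A x := (D.A x).mul_mem hg hg
    -- subgroup M
    let M : Subgroup G := 
      { carrier := {v | v ∈ H ∨ v * (g * g) ∈ H}
        one_mem' := Or.inl H.one_mem
        mul_mem' := by
          intro a b ha hb
          have comm2 : ∀ b ∈ D.N x hx, (b * (g * g) * b⁻¹ = g * g) ∨
              (b * (g * g) * b⁻¹ = (g * g)⁻¹) := by
            intro b hb
            by_cases hbA : b ∈ D.A x
            · left; rw [hcomm hbA hgg]; group
            · right; exact (D.S_inv hx hS ((mem_N hx).mp hb) hbA).1 _ hgg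
          have hN : ∀ c, c * (g * g) ∈ H → c ∈ D.N x hx := by
            intro c hc
            have := (D.N x hx).mul_mem (hH hc) ((D.N x hx).inv_mem (hAN hgg))
            simpa [mul_assoc] using this
          have hmg : ∀ c, c * (g * g)⁻¹ ∈ H ↔ c * (g * g) ∈ H := by
            intro c
            have e : c * (g * g) = c * (g * g)⁻¹ * (g * g * (g * g)) := by simp [mul_assoc]
            rw [e]
            exact (H.mul_mem_cancel_right hg4).symm
          have hmg' : ∀ c, c ∈ D.N x hx → (c * (g * g) ∈ H ↔ (g * g) * c ∈ H) := by
            intro c hc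
            rcases comm2 c hc with h | h
            · have e : c * (g * g) = (g * g) * c := by rw [mul_inv_eq_iff_eq_mul] at h; exact h
              rw [e]
            · have e : c * (g * g) = (g * g)⁻¹ * c := by rw [mul_inv_eq_iff_eq_mul] at h; exact h
              rw [e]
              have e2 : (g * g) * c = (g * g * (g * g)) * ((g * g)⁻¹ * c) := by simp [mul_assoc]
              rw [e2]
              exact (H.mul_mem_cancel_left hg4).symm
          rcases ha with ha | ha <;> rcases hb with hb | hb
          · exact Or.inl (H.mul_mem ha hb)
          · right; rw [mul_assoc]; exact H.mul_mem ha hb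
          · right
            have h1 : b⁻¹ ∈ D.N x hx := (D.N x hx).inv_mem (hH hb)
            have e : a * b * (g * g) = a * (b * (g * g) * b⁻¹) * b := by group
            rw [e]
            rcases comm2 b (hH hb) with h | h
            · rw [h]; exact H.mul_mem ha hb
            · rw [h]; exact H.mul_mem ((hmg a).mpr ha) hb
          · left
            have h2 := (hmg' b (hN b hb)).mp hb
            have e : a * b = (a * (g * g)⁻¹) * ((g * g) * b) := by group
            rw [e]; exact H.mul_mem ((hmg a).mpr ha) h2
        inv_mem' := by
          intro a ha
          rcases ha with ha | ha
          · exact Or.inl (H.inv_mem ha)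
          · right
            have hN : a ∈ D.N x hx := by
              have := (D.N x hx).mul_mem (hH ha) ((D.N x hx).inv_mem (hAN hgg))
              simpa [mul_assoc] using this
            have h1 := H.inv_mem ha
            by_cases haA : a ∈ D.A x
            · have e : a⁻¹ * (g * g) = (a * (g * g))⁻¹ * (g * g * (g * g)) := by
                rw [mul_inv_rev, hcomm ((D.A x).inv_mem hgg) ((D.A x).inv_mem haA)]; simp [mul_assoc]
              rw [e]; exact H.mul_mem h1 hg4
            · have h3 := (D.S_inv hx hS ((mem_N hx).mp hN) haA)
              have h4 := h3.1 _ hgg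
              have h5 : a⁻¹ = a := inv_eq_of_mul_eq_one_left h3.2
              rw [h5]; exact ha }
    intro v hv hvA
    have hle : H ⊔ H.conjugate g ≤ M := by
      refine sup_le (fun h hh => Or.inl hh) ?_
      intro c hc
      rw [mem_conjugate] at hc
      have hcN : c ∈ D.N x hx := by
        have h1 := (D.N x hx).mul_mem ((D.N x hx).mul_mem ((D.N x hx).inv_mem (hAN hg)) (hH hc)) (hAN hg)
        have e : g⁻¹ * (g * c * g⁻¹) * g = c := by group
        rwa [e] at h1
      by_cases hcA : c ∈ D.A x
      · left; rw [hcomm hg hcA] at hc; simpa using hc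
      · right
        have h1 := refl_conj hx hS hcN hcA ((D.A x).inv_mem hg)
        rw [inv_inv] at h1
        rw [h1] at hc
        have e : c * (g * g) = c * (g⁻¹ * g⁻¹) * (g * g * (g * g)) := by simp [mul_assoc]
        rw [e]; exact H.mul_mem hc hg4
    exact hle hv
  -- the rotation part `v` of `w`
  have main : ∀ v ∈ H ⊔ H.conjugate g, v ∈ D.A x → H.conjugate v = H.conjugate g → False := by
    intro v hv hvA hve
    have h1 : t * (g * g) ∈ H.conjugate v := by
      rw [hve, mem_conjugate, ← refl_conj hx hS (hH ht) htA hg]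
      have e : g * (g⁻¹ * t * g) * g⁻¹ = t := by group
      rw [e]; exact ht
    rw [mem_conjugate] at h1
    -- v t = t v⁻¹
    have h2 := refl_conj hx hS (hH ht) htA ((D.A x).inv_mem hvA)
    rw [inv_inv] at h2
    have hgg : g * g ∈ D.A x := (D.A x).mul_mem hg hg
    have e : v * (t * (g * g)) * v⁻¹ = t * (v⁻¹ * v⁻¹) * (g * g) := by
      rw [← h2, ← mul_assoc v, mul_assoc (v * t), hcomm hgg ((D.A x).inv_mem hvA)]; group
    rw [e, mul_assoc, H.mul_mem_cancel_left ht] at h1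
    have hvv : v * v ∈ H := by
      rcases key v hv hvA with h | h
      · exact H.mul_mem h h
      · have h3 := H.mul_mem h h
        have e2 : v * (g * g) * (v * (g * g)) = v * v * (g * g * (g * g)) := by
          rw [mul_assoc v, ← mul_assoc (g * g) v, hcomm hgg hvA]; group
        rw [e2, H.mul_mem_cancel_right hg4] at h3
        exact h3
    apply hg2
    have := H.mul_mem hvv h1
    have e3 : v * v * (v⁻¹ * v⁻¹ * (g * g)) = g * g := by group
    rwa [e3] at this
  by_cases hwA : w ∈ D.A x
  · exact main w hw hwA hwe
  · refine main (t * w) (Subgroup.mul_mem _ (Subgroup.mem_sup_left ht) hw)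
      (D.S_mul hx hS ((mem_N hx).mp (hH ht)) htA ((mem_N hx).mp hNw) hwA) ?_
    rw [conjugate_mul, conjugate_of_mem ht, hwe]
end PartData

namespace PartData
variable {G : Type*} [Group G] {D : PartData G}

theorem exists_ne_one_mem {H : Subgroup G} (h : H ≠ ⊥) : ∃ y ∈ H, y ≠ 1 := by
  by_contra hcon
  push Not at hcon
  exact h ((Subgroup.eq_bot_iff_forall H).mpr hcon)

theorem le_of_card_prime [Finite G] {H K : Subgroup G}
    (h : (Nat.card (H ⊔ K : Subgroup G)).Prime) : H ⊔ K = H ∨ H ⊔ K = K := by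
  have h1 : Nat.card H ∣ Nat.card (H ⊔ K : Subgroup G) :=
    Subgroup.card_dvd_of_le le_sup_left
  rcases (Nat.dvd_prime h).mp h1 with h2 | h2
  · right
    have := Subgroup.card_eq_one.mp h2
    rw [this, bot_sup_eq]
  · left
    exact (Subgroup.eq_of_le_of_card_ge le_sup_left (le_of_eq h2.symm)).symm

/-- Rotations whose square lies in `J` normalize `J`. -/
theorem conj_eq_of_sq [Finite G] {x : G} (hx : x ≠ 1) (hS : D.S x) {J : Subgroup G}
    (hJ : J ≤ D.N x hx) {g : G} (hg : g ∈ D.A x) (hgg : g * g ∈ J) : J.conjugate g = J := by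
  have h : J.conjugate g⁻¹ = J := by
    apply conjugate_eq_of_subset
    intro y hy
    by_cases hyA : y ∈ D.A x
    · rw [D.A_comm hx ((D.A x).inv_mem hg) hyA]; simpa using hy
    · rw [inv_inv, refl_conj hx hS (hJ hy) hyA hg]
      exact J.mul_mem hy hgg
  have := conjugate_inv_eq h
  rwa [inv_inv] at this

theorem pow_half (g : G) (k : ℕ) (hk : Odd k) (hg : g ^ k * g ^ k = 1) :
    ∃ w ∈ Subgroup.zpowers (g * g), ∃ z ∈ Subgroup.zpowers g, z * z = 1 ∧ g = z * w := by
  obtain ⟨m, rfl⟩ := hk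
  refine ⟨(g * g) ^ (m + 1), Subgroup.npow_mem_zpowers _ _, (g ^ (2 * m + 1))⁻¹,
    Subgroup.inv_mem _ (Subgroup.npow_mem_zpowers _ _), ?_, ?_⟩
  · rw [← mul_inv_rev, hg, inv_one]
  · rw [← pow_two, ← pow_mul, eq_inv_mul_iff_mul_eq, ← pow_succ]; congr 1

theorem dihedral_main [Finite G] {x : G} (hx : x ≠ 1) (hS : D.S x) {H K : Subgroup G}
    (hHp : IsPronormal H) (hKp : IsPronormal K) (hJ : H ⊔ K ≤ D.N x hx) {t : G} (ht : t ∈ H ⊔ K)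
    (htA : t ∉ D.A x) (hc : 2 < Nat.card ((H ⊔ K) ⊓ D.A x : Subgroup G)) :
    IsPronormal (H ⊔ K) := by
  set J := H ⊔ K with hJdef
  refine pronormal_of_sub (pronormal_cyclic hx hS inf_le_right hc) inf_le_left ?_
  -- reduce to rotations
  suffices hrot : ∀ g ∈ D.A x, ∃ w ∈ (J ⊔ J.conjugate g : Subgroup G),
      J.conjugate w = J.conjugate g by
    intro g hgC
    have hne : (J ⊓ D.A x) ≠ ⊥ := by
      intro h; rw [h] at hc; simp at hc
    obtain ⟨y, hy, hy1⟩ := exists_ne_one_mem hne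
    have hgN : g ∈ D.N x hx := by
      rw [← hgC, mem_conjugate] at hy
      have hy' : g * y * g⁻¹ ∈ D.A x := hy.2
      have hy2 : g⁻¹ ∈ D.N x hx := by
        have := hgC ▸ (mem_conjugate.mpr hy)
        refine mem_N_of_conj hx hy' (conj_ne_one g hy1) ?_
        have e : g⁻¹ * (g * y * g⁻¹) * g⁻¹⁻¹ = y := by group
        rw [e]; exact this.2
      simpa using (D.N x hx).inv_mem hy2
    rcases index_two hx hS (J := D.N x hx) le_rfl (hJ ht) htA g hgN with h | h
    · exact hrot g h
    · have := hrot _ h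
      rwa [conjugate_mul, conjugate_of_mem ht] at this
  intro g hg
  have hgg : g * g ∈ J ⊔ J.conjugate g := by
    have h1 : g⁻¹ * t * g ∈ J.conjugate g := by
      rw [mem_conjugate]; simpa [mul_assoc] using ht
    rw [refl_conj hx hS (hJ ht) htA hg] at h1
    have h2 := Subgroup.mul_mem (J ⊔ J.conjugate g)
      (Subgroup.mem_sup_left (J.inv_mem ht)) (Subgroup.mem_sup_right h1)
    simpa using h2
  by_cases hggJ : g * g ∈ J
  · exact ⟨1, Subgroup.one_mem _, by rw [conjugate_one, conj_eq_of_sq hx hS hJ hg hggJ]⟩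
  rcases D.S_card hx hS with h4 | ⟨k, hk⟩
  · -- no elements of order four
    have ho : orderOf g ∣ Nat.card (D.A x) := by
      have := orderOf_dvd_natCard (⟨g, hg⟩ : D.A x)
      rwa [← Subgroup.orderOf_coe] at this
    have ho4 : ¬ 4 ∣ orderOf g := fun h => h4 (h.trans ho)
    obtain ⟨k, hk, hgk⟩ : ∃ k, Odd k ∧ g ^ k * g ^ k = 1 := by
      rcases Nat.even_or_odd (orderOf g) with he | hodd
      · obtain ⟨m, hm⟩ := he
        refine ⟨m, ?_, ?_⟩
        · rcases Nat.even_or_odd m with hm2 | hm2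
          · exfalso; apply ho4; obtain ⟨l, hl⟩ := hm2; exact ⟨l, by omega⟩
          · exact hm2
        · rw [← pow_add, ← hm, pow_orderOf_eq_one]
      · exact ⟨orderOf g, hodd, by rw [pow_orderOf_eq_one]; simp⟩
    obtain ⟨w, hw, z, hz, hzz, hgzw⟩ := pow_half g k hk hgk
    refine ⟨w, ?_, ?_⟩
    · exact (Subgroup.zpowers_le.mpr hgg) hw
    · have hzA : z ∈ D.A x := (Subgroup.zpowers_le.mpr hg) hz
      have hzJ : J.conjugate z = J := conj_eq_of_sq hx hS hJ hzA (by rw [hzz]; exact J.one_mem)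
      rw [hgzw, conjugate_mul, hzJ]
  · exfalso
    -- a factor which is not inside the torus is not pronormal
    have key : ∀ M : Subgroup G, M ≤ J → IsPronormal M → M ≤ D.A x := by
      intro M hMJ hMp
      by_contra hcon
      obtain ⟨s, hsM, hsA⟩ := SetLike.not_le_iff_exists.mp hcon
      have hex : ∃ i, g ^ (2 ^ i) ∈ M := by
        refine ⟨k, ?_⟩
        have h1 : (⟨g, hg⟩ : D.A x) ^ Nat.card (D.A x) = 1 := pow_card_eq_one'
        rw [hk] at h1
        have h2 := congrArg Subtype.val h1
        have h3 : g ^ 2 ^ k = 1 := by simpa using h2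
        rw [h3]; exact M.one_mem
      classical
      have hfind := Nat.find_spec hex
      have hmin := fun m => Nat.find_min hex (m := m)
      generalize Nat.find hex = i at hfind hmin
      have hi2 : 2 ≤ i := by
        by_contra hlt
        have : i = 0 ∨ i = 1 := by omega
        rcases this with rfl | rfl
        · apply hggJ
          have : g ∈ M := by simpa using hfind
          exact hMJ (M.mul_mem this this)
        · apply hggJ
          have : g * g ∈ M := by simpa [pow_two] using hfind
          exact hMJ this
      obtain ⟨j, rfl⟩ : ∃ j, i = j + 2 := ⟨i - 2, by omega⟩
      refine not_pronormal_refl hx hS (hMJ.trans hJ) hsM hsA (g := g ^ 2 ^ j)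
        ((D.A x).pow_mem hg _) ?_ ?_ hMp
      · have := hmin (j + 1) (by omega)
        rw [← pow_add, show 2 ^ j + 2 ^ j = 2 ^ (j + 1) by ring]
        exact this
      · rw [← pow_add, ← pow_add, show 2 ^ j + 2 ^ j + (2 ^ j + 2 ^ j) = 2 ^ (j + 2) by ring]
        exact hfind
    have h1 : J ≤ D.A x := sup_le (key H le_sup_left hHp) (key K le_sup_right hKp)
    exact htA (h1 ht)

theorem exists_central_two [Finite G] {R : Subgroup G} (hR : IsPGroup 2 R)
    (hne : R ≠ ⊥) : ∃ z ∈ R, z ≠ 1 ∧ z * z = 1 ∧ ∀ y ∈ R, z * y = y * z := by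
  have : Nontrivial R := (Subgroup.nontrivial_iff_ne_bot R).mpr hne
  have : Fact (Nat.Prime 2) := ⟨Nat.prime_two⟩
  have hnt := hR.center_nontrivial
  have hp : IsPGroup 2 (Subgroup.center R) := hR.to_subgroup _
  have hd : 2 ∣ Nat.card (Subgroup.center R) := by
    obtain ⟨n, hn⟩ := IsPGroup.iff_card.mp hp
    have : n ≠ 0 := by
      rintro rfl
      have h1 : 1 < Nat.card (Subgroup.center R) := Finite.one_lt_card
      omega
    rw [hn]; exact dvd_pow_self 2 this
  obtain ⟨z, hz⟩ := exists_prime_orderOf_dvd_card' 2 hd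
  have hz2 : z ^ 2 = 1 := hz ▸ pow_orderOf_eq_one z
  refine ⟨z.1.1, z.1.2, ?_, ?_, ?_⟩
  · intro h
    have : z = 1 := by ext; simpa using h
    rw [this] at hz; simp at hz
  · rw [pow_two] at hz2
    have := congrArg (fun a => a.1.1) hz2
    simpa using this
  · intro y hy
    have := Subgroup.mem_center_iff.mp z.2 ⟨y, hy⟩
    exact (congrArg Subtype.val this).symm

theorem not_four_of_no_sqrt [Finite G] {z : G} (hz : z ≠ 1) (hzz : z * z = 1) (hS : D.S z)
    (h : ¬ ∃ y ∈ D.A z, y * y = z) : ¬ 4 ∣ Nat.card (D.A z) := by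
  rintro ⟨m, hm⟩
  have hcyc := D.S_cyc hz hS
  obtain ⟨a, ha⟩ := IsCyclic.exists_ofOrder_eq_natCard (α := D.A z)
  rw [← Subgroup.orderOf_coe] at ha
  have hm0 : m ≠ 0 := by
    rintro rfl
    have : 0 < Nat.card (D.A z) := Nat.card_pos
    omega
  have ho : orderOf ((a : G) ^ (2 * m)) = 2 := by
    rw [orderOf_pow_of_dvd (by omega) (by rw [ha, hm]; exact ⟨2, by ring⟩), ha, hm]
    have : 4 * m = 2 * (2 * m) := by ring
    rw [this, Nat.mul_div_cancel _ (by omega)]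
  have hoz : orderOf z = 2 := orderOf_eq_prime (by rw [pow_two, hzz]) hz
  have heq : Subgroup.zpowers z = Subgroup.zpowers ((a : G) ^ (2 * m)) := by
    apply cyclic_unique hcyc
    · exact Subgroup.zpowers_le.mpr (D.mem_self z)
    · exact Subgroup.zpowers_le.mpr ((D.A z).pow_mem a.2 _)
    · rw [Nat.card_zpowers, Nat.card_zpowers, ho, hoz]
  have hmem : z ∈ Subgroup.zpowers ((a : G) ^ (2 * m)) := heq ▸ Subgroup.mem_zpowers z
  classical
  rw [mem_zpowers_iff_mem_range_orderOf, ho] at hmem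
  simp only [Finset.mem_image, Finset.mem_range] at hmem
  obtain ⟨i, hi, hie⟩ := hmem
  interval_cases i
  · simp at hie; exact hz hie.symm
  · apply h
    refine ⟨(a : G) ^ m, (D.A z).pow_mem a.2 _, ?_⟩
    rw [← pow_add, ← two_mul]; rw [pow_one] at hie; exact hie

theorem klein_main [Finite G] {x : G} (hx : x ≠ 1) (hS : D.S x) {H K : Subgroup G}
    (hHp : IsPronormal H) (hKp : IsPronormal K) (hJ : H ⊔ K ≤ D.N x hx) {t : G} (ht : t ∈ H ⊔ K)
    (htA : t ∉ D.A x) (hc : Nat.card ((H ⊔ K) ⊓ D.A x : Subgroup G) = 2) :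
    IsPronormal (H ⊔ K) := by
  have hJ4 := card_index_two hx hS hJ ht htA
  set J := H ⊔ K with hJdef
  rw [hc] at hJ4
  have hne : (J ⊓ D.A x) ≠ ⊥ := by
    intro h; rw [h] at hc; simp at hc
  obtain ⟨z, hzJA, hz1⟩ := exists_ne_one_mem hne
  have hzz : z * z = 1 := by
    have h1 : (⟨z, hzJA⟩ : (J ⊓ D.A x : Subgroup G)) ^ Nat.card (J ⊓ D.A x : Subgroup G) = 1 :=
      pow_card_eq_one'
    rw [hc] at h1
    have := congrArg Subtype.val h1
    simpa [pow_two] using this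
  have hSz := D.S_of_mem hx hS hzJA.2 hz1
  have hAz := D.A_eq hx hzJA.2 hz1
  by_cases hsq : ∃ y ∈ D.A z, y * y = z
  · obtain ⟨y, hy, hyy⟩ := hsq
    rw [hAz] at hy
    have key : ∀ M : Subgroup G, M ≤ J → IsPronormal M → ¬ M ≤ D.A x → M = J := by
      intro M hMJ hMp hcon
      obtain ⟨s, hsM, hsA⟩ := SetLike.not_le_iff_exists.mp hcon
      by_cases hzM : z ∈ M
      · apply Subgroup.eq_of_le_of_card_ge hMJ
        have h2 := card_index_two hx hS (hMJ.trans hJ) hsM hsA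
        have h3 : M ⊓ D.A x ≠ ⊥ := by
          intro h
          have : z ∈ (⊥ : Subgroup G) := h ▸ ⟨hzM, hzJA.2⟩
          exact hz1 (Subgroup.mem_bot.mp this)
        have h4 : 1 < Nat.card (M ⊓ D.A x : Subgroup G) := (Subgroup.one_lt_card_iff_ne_bot _).mpr h3
        omega
      · exfalso
        refine not_pronormal_refl hx hS (hMJ.trans hJ) hsM hsA hy ?_ ?_ hMp
        · rw [hyy]; exact hzM
        · rw [hyy, hzz]; exact M.one_mem
    by_cases h1 : H ≤ D.A x
    · by_cases h2 : K ≤ D.A x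
      · exact absurd ((sup_le h1 h2) ht) htA
      · have := key K le_sup_right hKp h2
        rw [← this]; exact hKp
    · have := key H le_sup_left hHp h1
      rw [← this]; exact hHp
  · -- `J` is a Sylow subgroup
    intro g
    have : Fact (Nat.Prime 2) := ⟨Nat.prime_two⟩
    have hJ2 : IsPGroup 2 J := IsPGroup.of_card (n := 2) (by rw [hJ4]; norm_num)
    have hJg2 : IsPGroup 2 (J.conjugate g) :=
      IsPGroup.of_card (n := 2) (by rw [card_conjugate, hJ4]; norm_num)
    obtain ⟨w, hw, R, -, hRp, hR1, hR2⟩ := sylow_conj hJ2 hJg2 (L := J ⊔ J.conjugate g)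
      le_sup_left le_sup_right
    have hvR : g⁻¹ * z * g⁻¹⁻¹ ∈ R := by
      apply hR2; rw [mem_conjugate]; simpa [mul_assoc] using hzJA.1
    have hSv := D.S_conj g⁻¹ hSz
    have hv1 := conj_ne_one g⁻¹ hz1
    have hRne : R ≠ ⊥ := by
      rintro rfl; exact hv1 (Subgroup.mem_bot.mp hvR)
    obtain ⟨c, hcR, hc1, hcc, hccomm⟩ := exists_central_two hRp hRne
    have hSc : D.S c := by
      by_contra hSc
      have h1 := D.U_cent hc1 hSc (hccomm _ hvR).symm
      have h2 := D.A_eq hc1 h1 hv1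
      exact hSc (D.S_of_mem hv1 hSv (h2 ▸ D.mem_self c) hc1)
    have hnosq : ¬ ∃ y ∈ D.A c, y * y = c := by
      rintro ⟨y, hy, hyy⟩
      exact hsq (D.S_sqrt hc1 hz1 hcc hzz hSc hSz hy hyy)
    have h4 := not_four_of_no_sqrt hc1 hcc hSc hnosq
    have hRA : Nat.card (R ⊓ D.A c : Subgroup G) ≤ 2 := by
      have hp : IsPGroup 2 (R ⊓ D.A c : Subgroup G) := hRp.to_le inf_le_left
      obtain ⟨n, hn⟩ := IsPGroup.iff_card.mp hp
      have hd : Nat.card (R ⊓ D.A c : Subgroup G) ∣ Nat.card (D.A c) :=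
        Subgroup.card_dvd_of_le inf_le_right
      rw [hn] at hd ⊢
      by_contra hcon
      have hn2 : 2 ≤ n := by
        by_contra hlt
        have : n = 0 ∨ n = 1 := by omega
        rcases this with rfl | rfl <;> simp at hcon
      exact h4 ((pow_dvd_pow 2 hn2).trans hd)
    have hRN : R ≤ D.N c hc1 := fun y hy => mem_N_of_comm hc1 (hccomm y hy).symm
    have hR4 : Nat.card R ≤ 4 := by
      by_cases hle : R ≤ D.A c
      · rw [inf_eq_left.mpr hle] at hRA; omega
      · obtain ⟨s, hsM, hsA⟩ := SetLike.not_le_iff_exists.mp hle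
        have := card_index_two hc1 hSc hRN hsM hsA
        omega
    refine ⟨w, hw, ?_⟩
    have e1 := Subgroup.eq_of_le_of_card_ge hR1 (by rw [card_conjugate, hJ4]; exact hR4)
    have e2 := Subgroup.eq_of_le_of_card_ge hR2 (by rw [card_conjugate, hJ4]; exact hR4)
    rw [e1, e2]

theorem unip_main [Finite G] {u : G} (hu : u ≠ 1) (hS : ¬ D.S u) {H K : Subgroup G}
    (hHp : IsPronormal H) (hKp : IsPronormal K) (hJ : H ⊔ K ≤ D.A u) :
    IsPronormal (H ⊔ K) := by
  have hHA : H ≤ D.A u := le_sup_left.trans hJ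
  have hn : ∀ g, g * u * g⁻¹ ∈ D.A u → ∀ h ∈ H, g * h * g⁻¹ ∈ H := by
    intro g hg h hh
    have hgN : g ∈ D.N u hu := (mem_N hu).mpr hg
    obtain ⟨w, hw, hwe⟩ := hHp g
    have hle : H ⊔ H.conjugate g ≤ D.A u := by
      refine sup_le hHA ?_
      intro y hy
      rw [mem_conjugate] at hy
      have := conj_mem_of_N hu ((D.N u hu).inv_mem hgN) (hHA hy)
      simpa [mul_assoc] using this
    have hwH : H.conjugate w = H := by
      apply conjugate_eq_of_subset
      intro y hy
      rw [D.A_comm hu (hle hw) (hHA hy)]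
      simpa using hy
    rw [← mem_conjugate, ← hwe, hwH]; exact hh
  rcases D.U_simple hu hS H hHA hn with h | h
  · rw [h, bot_sup_eq]; exact hKp
  · have : H ⊔ K = H := le_antisymm (h ▸ hJ) le_sup_left
    rw [this]; exact hHp

theorem borel_main [Finite G] {u : G} (hu : u ≠ 1) (hS : ¬ D.S u) {J : Subgroup G}
    (hJ : J ≤ D.N u hu) (hA : D.A u ≤ J) : IsPronormal J := by
  intro g
  by_cases hg : g ∈ D.N u hu
  · refine ⟨1, Subgroup.one_mem _, ?_⟩
    rw [conjugate_one]
    symm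
    apply conjugate_eq_of_subset
    intro y hy
    have := J.mul_mem (hA (D.U_comm hu hS ((mem_N hu).mp hg) ((mem_N hu).mp (hJ hy)))) hy
    simpa [mul_assoc] using this
  · refine ⟨g, ?_, rfl⟩
    have htop : J ⊔ J.conjugate g = ⊤ := by
      refine D.U_gen (u := u) (v := g⁻¹ * u * g⁻¹⁻¹) _ hu hS (conj_ne_one _ hu) ?_ ?_
        (hA.trans le_sup_left) ?_
      · intro h
        have := D.S_conj g h
        apply hS
        simpa [mul_assoc] using this
      · intro h
        apply hg
        have : g⁻¹ ∈ D.N u hu := h.symm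
        simpa using (D.N u hu).inv_mem this
      · refine le_trans ?_ le_sup_right
        intro y hy
        rw [mem_conjugate]
        apply hA
        have := D.A_conj g hy
        simpa [mul_assoc] using this
    rw [htop]; exact Subgroup.mem_top g

theorem semi_main [Finite G] {x : G} (hx : x ≠ 1) (hS : D.S x) {H K : Subgroup G}
    (hHp : IsPronormal H) (hKp : IsPronormal K) (hJ : H ⊔ K ≤ D.N x hx) :
    IsPronormal (H ⊔ K) := by
  have two : Nat.card (H ⊔ K : Subgroup G) ≤ 2 → IsPronormal (H ⊔ K) := by
    intro h
    have hpos : 0 < Nat.card (H ⊔ K : Subgroup G) := Nat.card_pos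
    have : Nat.card (H ⊔ K : Subgroup G) = 1 ∨ Nat.card (H ⊔ K : Subgroup G) = 2 := by omega
    rcases this with h1 | h2
    · rw [Subgroup.card_eq_one.mp h1]; exact isPronormal_bot
    · rcases le_of_card_prime (h2 ▸ Nat.prime_two) with h | h <;> rw [h] <;> assumption
  by_cases hle : H ⊔ K ≤ D.A x
  · by_cases h2 : 2 < Nat.card (H ⊔ K : Subgroup G)
    · exact pronormal_cyclic hx hS hle h2
    · exact two (by omega)
  · obtain ⟨t, ht, htA⟩ := SetLike.not_le_iff_exists.mp hle
    have hc := card_index_two hx hS hJ ht htA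
    rcases lt_trichotomy (Nat.card ((H ⊔ K) ⊓ D.A x : Subgroup G)) 2 with h | h | h
    · exact two (by omega)
    · exact klein_main hx hS hHp hKp hJ ht htA h
    · exact dihedral_main hx hS hHp hKp hJ ht htA h

theorem N_main [Finite G] {x : G} (hx : x ≠ 1) {H K : Subgroup G}
    (hHp : IsPronormal H) (hKp : IsPronormal K) (hJ : H ⊔ K ≤ D.N x hx) :
    IsPronormal (H ⊔ K) := by
  by_cases hS : D.S x
  · exact semi_main hx hS hHp hKp hJ
  have case1 : ∀ u (hu : u ≠ 1), ¬ D.S u → u ∈ H ⊔ K → H ⊔ K ≤ D.N u hu → IsPronormal (H ⊔ K) := by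
    intro u hu hSu huJ hJu
    by_cases hle : H ⊔ K ≤ D.A u
    · exact unip_main hu hSu hHp hKp hle
    · obtain ⟨t, ht, htA⟩ := SetLike.not_le_iff_exists.mp hle
      exact borel_main hu hSu hJu (D.U_full _ hu hSu huJ ht ((mem_N hu).mp (hJu ht)) htA)
  by_cases hE : (H ⊔ K) ⊓ D.A x = ⊥
  · by_cases hbot : H ⊔ K = ⊥
    · rw [hbot]; exact isPronormal_bot
    obtain ⟨y, hy, hy1⟩ := exists_ne_one_mem hbot
    have hJy : H ⊔ K ≤ D.N y hy1 := by
      intro j hj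
      apply mem_N_of_comm hy1
      have h1 := D.U_comm hx hS ((mem_N hx).mp (hJ hj)) ((mem_N hx).mp (hJ hy))
      have h2 : j * y * j⁻¹ * y⁻¹ ∈ (H ⊔ K) ⊓ D.A x :=
        ⟨Subgroup.mul_mem _ (Subgroup.mul_mem _ (Subgroup.mul_mem _ hj hy)
          (Subgroup.inv_mem _ hj)) (Subgroup.inv_mem _ hy), h1⟩
      rw [hE, Subgroup.mem_bot, mul_inv_eq_one, mul_inv_eq_iff_eq_mul] at h2
      exact h2
    by_cases hSy : D.S y
    · exact semi_main hy1 hSy hHp hKp hJy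
    · exact case1 y hy1 hSy hy hJy
  · obtain ⟨u, hu, hu1⟩ := exists_ne_one_mem hE
    refine case1 u hu1 ?_ hu.1 ?_
    · intro h
      apply hS
      have h1 := D.A_eq hx hu.2 hu1
      exact D.S_of_mem hu1 h (h1 ▸ D.mem_self x) hx
    · intro j hj
      exact mem_N_of_conj hu1 (D.mem_self u) hu1 (by
        rw [D.A_eq hx hu.2 hu1]; exact conj_mem_of_N hx (hJ hj) hu.2)

end PartData

namespace PartData
variable {G : Type*} [Group G] {D : PartData G}

/-! ### Exotic subgroups: counting -/

variable (D) in
/-- `J` is not contained in any normalizer of a partition component. -/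
def Exotic (J : Subgroup G) : Prop := ∀ x (hx : x ≠ 1), ¬ J ≤ D.N x hx

variable (D) in
/-- The nontrivial elements of `J` that are `J`-conjugate into `A x`. -/
def T (J : Subgroup G) (x : G) : Set G := {z | z ∈ J ∧ z ≠ 1 ∧ ∃ g ∈ J, g * z * g⁻¹ ∈ D.A x}

variable (D) in
/-- No element of `J` acts on a unipotent component it meets. -/
def NF (J : Subgroup G) : Prop :=
  ∀ u ∈ J, u ≠ 1 → ¬ D.S u → ∀ g ∈ J, g * u * g⁻¹ ∈ D.A u → g ∈ D.A u

theorem exotic_mono {J L : Subgroup G} (hJ : D.Exotic J) (h : J ≤ L) : D.Exotic L :=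
  fun x hx hl => hJ x hx (h.trans hl)

theorem exotic_NF {J : Subgroup G} (hJ : D.Exotic J) : D.NF J ∨ J = ⊤ := by
  by_contra hcon
  push Not at hcon
  obtain ⟨h1, h2⟩ := hcon
  unfold NF at h1
  push Not at h1
  obtain ⟨u, huJ, hu, hS, g, hg, hgu, hgA⟩ := h1
  have hA := D.U_full J hu hS huJ hg hgu hgA
  have h3 := hJ u hu
  rw [SetLike.not_le_iff_exists] at h3
  obtain ⟨k, hk, hkN⟩ := h3
  apply h2
  refine D.U_gen J hu hS (conj_ne_one k hu) ?_ (fun h => hkN h.symm) hA ?_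
  · intro h
    have := D.S_conj k⁻¹ h
    simp only [inv_inv, mul_assoc, inv_mul_cancel_left, inv_mul_cancel, mul_one] at this
    exact hS this
  · intro y hy
    have h4 := D.A_conj k⁻¹ hy
    have h5 : k⁻¹ * (k * u * k⁻¹) * k⁻¹⁻¹ = u := by group
    rw [h5] at h4
    have h6 := J.mul_mem (J.mul_mem hk (hA h4)) (J.inv_mem hk)
    have h7 : k * (k⁻¹ * y * k⁻¹⁻¹) * k⁻¹ = y := by group
    rwa [h7] at h6

theorem card_sub [Fintype G] [DecidableEq G] (P : Subgroup G) (s : Finset G)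
    (h : ∀ x, x ∈ s ↔ x ∈ P) : s.card = Nat.card P :=
  (Nat.subtype_card s h).symm

theorem T_count [Finite G] {J : Subgroup G} {x : G} (hx : x ≠ 1) :
    Nat.card (D.T J x) * Nat.card (J ⊓ D.N x hx : Subgroup G) =
      Nat.card J * (Nat.card (J ⊓ D.A x : Subgroup G) - 1) := by
  classical
  have := Fintype.ofFinite G
  set s : Finset G := Finset.univ.filter (· ∈ D.T J x) with hs
  set t : Finset G := Finset.univ.filter (· ∈ J) with ht
  have key := Finset.sum_card_bipartiteAbove_eq_sum_card_bipartiteBelow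
    (s := s) (t := t) (fun z g => g * z * g⁻¹ ∈ D.A x)
  have e1 : ∀ z ∈ s, (Finset.bipartiteAbove (fun z g => g * z * g⁻¹ ∈ D.A x) t z).card =
      Nat.card (J ⊓ D.N x hx : Subgroup G) := by
    intro z hz
    simp only [hs, Finset.mem_filter, Finset.mem_univ, true_and] at hz
    obtain ⟨hzJ, hz1, g0, hg0, hg0A⟩ := hz
    rw [← card_sub (J ⊓ D.N x hx) (Finset.univ.filter (· ∈ J ⊓ D.N x hx)) (by simp)]
    refine Finset.card_nbij' (fun g => g * g0⁻¹) (fun h => h * g0) ?_ ?_ ?_ ?_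
    · intro g hg
      simp only [Finset.coe_filter, Finset.mem_bipartiteAbove, Set.mem_ofPred_eq, Finset.mem_coe,
        Finset.mem_filter, Finset.mem_univ, true_and, ht, Subgroup.mem_inf] at hg ⊢
      refine ⟨J.mul_mem hg.1 (J.inv_mem hg0), mem_N_of_conj hx hg0A (conj_ne_one _ hz1) ?_⟩
      have : g * g0⁻¹ * (g0 * z * g0⁻¹) * (g * g0⁻¹)⁻¹ = g * z * g⁻¹ := by group
      rw [this]; exact hg.2
    · intro h hh
      simp only [Finset.coe_filter, Finset.mem_bipartiteAbove, Set.mem_ofPred_eq, Finset.mem_coe,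
        Finset.mem_filter, Finset.mem_univ, true_and, ht, Subgroup.mem_inf] at hh ⊢
      refine ⟨J.mul_mem hh.1 hg0, ?_⟩
      have := conj_mem_of_N hx hh.2 hg0A
      have e : h * g0 * z * (h * g0)⁻¹ = h * (g0 * z * g0⁻¹) * h⁻¹ := by group
      rw [e]; exact this
    · intro g _; simp
    · intro g _; simp
  have e2 : ∀ g ∈ t, (Finset.bipartiteBelow (fun z g => g * z * g⁻¹ ∈ D.A x) s g).card =
      Nat.card (J ⊓ D.A x : Subgroup G) - 1 := by
    intro g hg
    simp only [ht, Finset.mem_filter, Finset.mem_univ, true_and] at hg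
    rw [← card_sub (J ⊓ D.A x) (Finset.univ.filter (· ∈ J ⊓ D.A x)) (by simp),
      ← Finset.card_erase_of_mem (a := 1) (by simp [Subgroup.one_mem])]
    refine Finset.card_nbij' (fun z => g * z * g⁻¹) (fun z => g⁻¹ * z * g) ?_ ?_ ?_ ?_
    · intro z hz
      simp only [Finset.mem_bipartiteBelow, Set.mem_ofPred_eq, Finset.mem_coe,
        Finset.mem_filter, Finset.mem_univ, true_and, hs, Subgroup.mem_inf, Finset.mem_erase] at hz ⊢
      obtain ⟨⟨h1, h2, -⟩, h4⟩ := hz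
      exact ⟨conj_ne_one _ h2, J.mul_mem (J.mul_mem hg h1) (J.inv_mem hg), h4⟩
    · intro z hz
      simp only [Finset.mem_bipartiteBelow, Set.mem_ofPred_eq, Finset.mem_coe,
        Finset.mem_filter, Finset.mem_univ, true_and, hs, Subgroup.mem_inf, Finset.mem_erase] at hz ⊢
      obtain ⟨h1, h2, h3⟩ := hz
      have e : g * (g⁻¹ * z * g) * g⁻¹ = z := by group
      have h5 : g⁻¹ * z * g ≠ 1 := by
        have := conj_ne_one g⁻¹ h1
        rwa [inv_inv] at this
      refine ⟨⟨J.mul_mem (J.mul_mem (J.inv_mem hg) h2) hg, h5, g, hg, ?_⟩, ?_⟩ <;> rw [e] <;> exact h3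
    · intro z _; simp [mul_assoc]
    · intro z _; simp [mul_assoc]
  rw [Finset.sum_congr rfl e1, Finset.sum_congr rfl e2, Finset.sum_const, Finset.sum_const] at key
  have c1 : s.card = Nat.card (D.T J x) := (Nat.subtype_card s (by simp [hs])).symm
  have c2 : t.card = Nat.card J := (Nat.subtype_card t (by simp [ht])).symm
  rw [← c1, ← c2]
  simpa using key

theorem T_sub {J : Subgroup G} {x x' : G} (hx : x ≠ 1) (h : x' ∈ D.T J x) :
    D.T J x ⊆ D.T J x' := by
  obtain ⟨hJ, h1, g, hg, hgA⟩ := h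
  rintro z ⟨hz, hz1, k, hk, hkA⟩
  refine ⟨hz, hz1, g⁻¹ * k, J.mul_mem (J.inv_mem hg) hk, ?_⟩
  have e := D.A_eq hx hgA (conj_ne_one _ h1)
  rw [← e] at hkA
  have := D.A_conj g⁻¹ hkA
  have e1 : g⁻¹ * (g * x' * g⁻¹) * g⁻¹⁻¹ = x' := by group
  have e2 : g⁻¹ * (k * z * k⁻¹) * g⁻¹⁻¹ = g⁻¹ * k * z * (g⁻¹ * k)⁻¹ := by group
  rwa [e1, e2] at this

theorem T_symm {J : Subgroup G} {x x' : G} (hx : x ≠ 1) (hxJ : x ∈ J) (h : x' ∈ D.T J x) :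
    x ∈ D.T J x' :=
  T_sub hx h ⟨hxJ, hx, 1, J.one_mem, by simpa using D.mem_self x⟩

theorem T_disj {J : Subgroup G} {x y : G} (hx : x ≠ 1) (hy : y ≠ 1) (hxJ : x ∈ J) (hyJ : y ∈ J)
    (h : y ∉ D.T J x) : Disjoint (D.T J x) (D.T J y) := by
  rw [Set.disjoint_left]
  intro z hz hz'
  apply h
  have h1 := T_symm hy hyJ hz'
  exact (T_sub hz.2.1 (T_symm hx hxJ hz)) h1

/-- The data of one class, as numbers. -/
theorem class_data [Finite G] {J : Subgroup G} (hE : D.Exotic J) (hNF : D.NF J) {x : G} (hx : x ≠ 1)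
    (hxJ : x ∈ J) : ∃ m c n, 2 ≤ m ∧ 2 ≤ c ∧ (n = c ∨ n = 2 * c) ∧ Nat.card J = m * n ∧
      Nat.card (D.T J x) = m * (c - 1) ∧ n = Nat.card (J ⊓ D.N x hx : Subgroup G) := by
  have hT := T_count (D := D) (J := J) hx
  have hd : Nat.card (J ⊓ D.N x hx : Subgroup G) ∣ Nat.card J := Subgroup.card_dvd_of_le inf_le_left
  obtain ⟨m, hm⟩ := hd
  have hpos : 0 < Nat.card (J ⊓ D.N x hx : Subgroup G) := Nat.card_pos
  have hJpos : 0 < Nat.card J := Nat.card_pos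
  refine ⟨m, Nat.card (J ⊓ D.A x : Subgroup G), _, ?_, ?_, ?_, by rw [hm, mul_comm], ?_, rfl⟩
  · by_contra h
    have : m = 0 ∨ m = 1 := by omega
    rcases this with rfl | rfl
    · simp at hm; omega
    · rw [mul_one] at hm
      have := Subgroup.eq_of_le_of_card_ge (inf_le_left : J ⊓ D.N x hx ≤ J) hm.le
      exact hE x hx (inf_eq_left.mp this)
  · have : (J ⊓ D.A x) ≠ ⊥ := by
      intro h
      have : x ∈ J ⊓ D.A x := ⟨hxJ, D.mem_self x⟩
      rw [h, Subgroup.mem_bot] at this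
      exact hx this
    have := (Subgroup.one_lt_card_iff_ne_bot _).mpr this
    omega
  · by_cases h : J ⊓ D.N x hx ≤ D.A x
    · left
      congr 2
      exact le_antisymm (le_inf inf_le_left h) (inf_le_inf_left _ (A_le_N hx))
    · right
      rw [SetLike.not_le_iff_exists] at h
      obtain ⟨t, ht, htA⟩ := h
      have hS : D.S x := by
        by_contra hS
        exact htA (hNF x hxJ hx hS t ht.1 ((mem_N hx).mp ht.2))
      have := card_index_two hx hS inf_le_right ht htA
      rw [this, inf_assoc, inf_eq_right.mpr (A_le_N hx)]
  · rw [hm] at hT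
    have : Nat.card (J ⊓ D.N x hx : Subgroup G) * Nat.card (D.T J x) =
      Nat.card (J ⊓ D.N x hx : Subgroup G) * (m * (Nat.card (J ⊓ D.A x : Subgroup G) - 1)) := by
      rw [mul_comm, hT]; ring
    exact Nat.eq_of_mul_eq_mul_left hpos this


theorem class_num [Finite G] {J : Subgroup G} (hE : D.Exotic J) (hNF : D.NF J) {x : G} (hx : x ≠ 1)
    (hxJ : x ∈ J) : ∃ m t n g, t = Nat.card (D.T J x) ∧ g = Nat.card J ∧
      n = Nat.card (J ⊓ D.N x hx : Subgroup G) ∧ 2 ≤ m ∧ m ≤ g ∧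
      ((t + m = g ∧ (2 * m = g ∨ 3 * m = g ∨ 4 * m ≤ g)) ∨
       (2 * (t + m) = g ∧ ((4 * m = g ∧ n = 4) ∨ (6 * m = g ∧ n = 6) ∨ (8 * m = g ∧ n = 8) ∨
         (10 * m = g ∧ n = 10) ∨ 12 * m ≤ g))) := by
  obtain ⟨m, c, n, hm, hc, hn, hg, ht, hn'⟩ := class_data hE hNF hx hxJ
  refine ⟨m, _, n, _, rfl, rfl, hn', hm, ?_, ?_⟩
  · rw [hg]; exact Nat.le_mul_of_pos_right _ (by omega)
  rw [hg, ht]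
  obtain ⟨d, rfl⟩ : ∃ d, c = d + 2 := ⟨c - 2, by omega⟩
  have e : d + 2 - 1 = d + 1 := by omega
  rw [e]
  rcases hn with rfl | rfl
  · left
    refine ⟨by ring, ?_⟩
    have : d = 0 ∨ d = 1 ∨ 2 ≤ d := by omega
    rcases this with rfl | rfl | h
    · left; ring
    · right; left; ring
    · right; right; nlinarith
  · right
    refine ⟨by ring, ?_⟩
    have : d = 0 ∨ d = 1 ∨ d = 2 ∨ d = 3 ∨ 4 ≤ d := by omega
    rcases this with rfl | rfl | rfl | rfl | h
    · left; constructor <;> ring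
    · right; left; constructor <;> ring
    · right; right; left; constructor <;> ring
    · right; right; right; left; constructor <;> ring
    · right; right; right; right; nlinarith

theorem num_w1 {g m t n : ℕ}
    (h : ((t + m = g ∧ (2 * m = g ∨ 3 * m = g ∨ 4 * m ≤ g)) ∨
       (2 * (t + m) = g ∧ ((4 * m = g ∧ n = 4) ∨ (6 * m = g ∧ n = 6) ∨ (8 * m = g ∧ n = 8) ∨
         (10 * m = g ∧ n = 10) ∨ 12 * m ≤ g)))) :
    (t + m = g ∧ 2 * m ≤ g) ∨
       (2 * (t + m) = g ∧ ((4 * m = g ∧ n = 4) ∨ (6 * m = g ∧ n = 6) ∨ (8 * m = g ∧ n = 8) ∨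
         (10 * m = g ∧ n = 10) ∨ 12 * m ≤ g)) := by
  omega

theorem num_w2 {g m t n : ℕ}
    (h : ((t + m = g ∧ (2 * m = g ∨ 3 * m = g ∨ 4 * m ≤ g)) ∨
       (2 * (t + m) = g ∧ ((4 * m = g ∧ n = 4) ∨ (6 * m = g ∧ n = 6) ∨ (8 * m = g ∧ n = 8) ∨
         (10 * m = g ∧ n = 10) ∨ 12 * m ≤ g)))) :
    (t + m = g ∧ 2 * m ≤ g) ∨
       (2 * (t + m) = g ∧ (4 * m = g ∨ 6 * m = g ∨ 8 * m = g ∨ 10 * m = g ∨ 12 * m ≤ g)) := by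
  omega

theorem num_b {g m t n : ℕ}
    (h : ((t + m = g ∧ (2 * m = g ∨ 3 * m = g ∨ 4 * m ≤ g)) ∨
       (2 * (t + m) = g ∧ ((4 * m = g ∧ n = 4) ∨ (6 * m = g ∧ n = 6) ∨ (8 * m = g ∧ n = 8) ∨
         (10 * m = g ∧ n = 10) ∨ 12 * m ≤ g)))) :
    g ≤ 4 * t := by
  omega

theorem num2 {g m1 t1 n1 m2 t2 n2 : ℕ} (h : t1 + t2 + 1 = g)
    (hm1 : 2 ≤ m1) (hm2 : 2 ≤ m2)
    (h1 : ((t1 + m1 = g ∧ (2 * m1 = g ∨ 3 * m1 = g ∨ 4 * m1 ≤ g)) ∨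
       (2 * (t1 + m1) = g ∧ ((4 * m1 = g ∧ n1 = 4) ∨ (6 * m1 = g ∧ n1 = 6) ∨ (8 * m1 = g ∧ n1 = 8) ∨
         (10 * m1 = g ∧ n1 = 10) ∨ 12 * m1 ≤ g))))
    (h2 : ((t2 + m2 = g ∧ (2 * m2 = g ∨ 3 * m2 = g ∨ 4 * m2 ≤ g)) ∨
       (2 * (t2 + m2) = g ∧ ((4 * m2 = g ∧ n2 = 4) ∨ (6 * m2 = g ∧ n2 = 6) ∨ (8 * m2 = g ∧ n2 = 8) ∨
         (10 * m2 = g ∧ n2 = 10) ∨ 12 * m2 ≤ g)))) :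
    g = 12 ∨ g = 24 ∨ (g = 60 ∧ n1 ≤ 10) := by
  rcases h1 with ⟨h1, k1⟩ | ⟨h1, k1⟩ <;> rcases h2 with ⟨h2, k2⟩ | ⟨h2, k2⟩ <;> omega

theorem num3 {g m1 t1 n1 m2 t2 m3 t3 : ℕ} (h : t1 + t2 + t3 + 1 = g)
    (hm1 : 2 ≤ m1) (hm2 : 2 ≤ m2) (hm3 : 2 ≤ m3)
    (h1 : (t1 + m1 = g ∧ 2 * m1 ≤ g) ∨
       (2 * (t1 + m1) = g ∧ ((4 * m1 = g ∧ n1 = 4) ∨ (6 * m1 = g ∧ n1 = 6) ∨ (8 * m1 = g ∧ n1 = 8) ∨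
         (10 * m1 = g ∧ n1 = 10) ∨ 12 * m1 ≤ g)))
    (h2 : (t2 + m2 = g ∧ 2 * m2 ≤ g) ∨
       (2 * (t2 + m2) = g ∧ (4 * m2 = g ∨ 6 * m2 = g ∨ 8 * m2 = g ∨
         10 * m2 = g ∨ 12 * m2 ≤ g)))
    (h3 : (t3 + m3 = g ∧ 2 * m3 ≤ g) ∨
       (2 * (t3 + m3) = g ∧ (4 * m3 = g ∨ 6 * m3 = g ∨ 8 * m3 = g ∨
         10 * m3 = g ∨ 12 * m3 ≤ g))) :
    g = 12 ∨ g = 24 ∨ (g = 60 ∧ n1 ≤ 10) := by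
  have b1 : g ≤ 4 * t1 := by omega
  have b2 : g ≤ 4 * t2 := by omega
  have b3 : g ≤ 4 * t3 := by omega
  rcases h1 with h1 | ⟨h1, k1⟩
  · omega
  rcases h2 with h2 | ⟨h2, k2⟩
  · omega
  rcases h3 with h3 | ⟨h3, k3⟩
  · omega
  have e : 2 * m1 + 2 * m2 + 2 * m3 = g + 2 := by omega
  clear h1 h2 h3 b1 b2 b3 h
  rcases k1 with k1 | k1 | k1 | k1 | k1 <;> rcases k2 with k2 | k2 | k2 | k2 | k2 <;>
    rcases k3 with k3 | k3 | k3 | k3 | k3 <;> omega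

theorem exotic_card [Finite G] {J : Subgroup G} (hE : D.Exotic J) (hNF : D.NF J) {x : G} (hx : x ≠ 1)
    (hxJ : x ∈ J) : Nat.card J = 12 ∨ Nat.card J = 24 ∨
      (Nat.card J = 60 ∧ Nat.card (J ⊓ D.N x hx : Subgroup G) ≤ 10) := by
  classical
  have hW : Nat.card ((J : Set G) \ {1} : Set G) + 1 = Nat.card J := by
    rw [Nat.card_coe_set_eq, Set.ncard_diff_singleton_add_one J.one_mem (Set.toFinite _)]
    rfl
  have hsub : ∀ y, D.T J y ⊆ (J : Set G) \ {1} := fun y z hz => ⟨hz.1, hz.2.1⟩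
  obtain ⟨m1, t1, n1, g, ht1, hg, hn1, hm1, hmg1, hd1⟩ := class_num hE hNF hx hxJ
  by_cases h1 : D.T J x = (J : Set G) \ {1}
  · rw [← h1, ← ht1, ← hg] at hW
    omega
  obtain ⟨y, hy, hyT⟩ := Set.exists_of_ssubset ((hsub x).ssubset_of_ne h1)
  have hy1 : y ≠ 1 := hy.2
  obtain ⟨m2, t2, n2, g2, ht2, hg2, hn2, hm2, hmg2, hd2⟩ := class_num hE hNF hy1 hy.1
  have d12 := T_disj hx hy1 hxJ hy.1 hyT
  have c12 := Set.ncard_union_eq d12 (Set.toFinite _) (Set.toFinite _)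
  rw [← Nat.card_coe_set_eq (D.T J x), ← Nat.card_coe_set_eq (D.T J y), ← ht1, ← ht2] at c12
  have hg2' : g2 = g := by rw [hg, hg2]
  subst hg2'
  by_cases h2 : D.T J x ∪ D.T J y = (J : Set G) \ {1}
  · rw [← h2, Nat.card_coe_set_eq, c12, ← hg] at hW
    rw [← hg, ← hn1]
    exact num2 hW hm1 hm2 hd1 hd2
  obtain ⟨z, hz, hzT⟩ := Set.exists_of_ssubset
    ((Set.union_subset (hsub x) (hsub y)).ssubset_of_ne h2)
  have hz1 : z ≠ 1 := hz.2
  rw [Set.mem_union, not_or] at hzT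
  obtain ⟨m3, t3, n3, g3, ht3, hg3, hn3, hm3, hmg3, hd3⟩ := class_num hE hNF hz1 hz.1
  have hg3' : g3 = g2 := by rw [hg, hg3]
  subst hg3'
  have d123 : Disjoint (D.T J x ∪ D.T J y) (D.T J z) :=
    Set.disjoint_union_left.mpr ⟨T_disj hx hz1 hxJ hz.1 hzT.1, T_disj hy1 hz1 hy.1 hz.1 hzT.2⟩
  have c123 := Set.ncard_union_eq d123 (Set.toFinite _) (Set.toFinite _)
  rw [c12, ← Nat.card_coe_set_eq (D.T J z), ← ht3] at c123
  by_cases h3 : D.T J x ∪ D.T J y ∪ D.T J z = (J : Set G) \ {1}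
  · rw [← h3, Nat.card_coe_set_eq, c123, ← hg] at hW
    rw [← hg, ← hn1]
    exact num3 hW hm1 hm2 hm3 (num_w1 hd1) (num_w2 hd2) (num_w2 hd3)
  obtain ⟨w, hw, hwT⟩ := Set.exists_of_ssubset
    ((Set.union_subset (Set.union_subset (hsub x) (hsub y)) (hsub z)).ssubset_of_ne h3)
  have hw1 : w ≠ 1 := hw.2
  simp only [Set.mem_union, not_or] at hwT
  obtain ⟨m4, t4, n4, g4, ht4, hg4, hn4, hm4, hmg4, hd4⟩ := class_num hE hNF hw1 hw.1
  have d1234 : Disjoint (D.T J x ∪ D.T J y ∪ D.T J z) (D.T J w) :=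
    Set.disjoint_union_left.mpr ⟨Set.disjoint_union_left.mpr
      ⟨T_disj hx hw1 hxJ hw.1 hwT.1.1, T_disj hy1 hw1 hy.1 hw.1 hwT.1.2⟩,
      T_disj hz1 hw1 hz.1 hw.1 hwT.2⟩
  have c1234 := Set.ncard_union_eq d1234 (Set.toFinite _) (Set.toFinite _)
  rw [c123, ← Nat.card_coe_set_eq (D.T J w), ← ht4] at c1234
  have hle := Set.ncard_le_ncard (Set.union_subset (Set.union_subset
    (Set.union_subset (hsub x) (hsub y)) (hsub z)) (hsub w)) (Set.toFinite _)
  rw [c1234, ← Nat.card_coe_set_eq] at hle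
  have hg4' : g4 = g3 := by rw [hg, hg4]
  subst hg4'
  rw [← hg] at hW
  exfalso
  have b1 : g4 ≤ 4 * t1 := num_b hd1
  have b2 : g4 ≤ 4 * t2 := num_b hd2
  have b3 : g4 ≤ 4 * t3 := num_b hd3
  have b4 : g4 ≤ 4 * t4 := num_b hd4
  clear hd1 hd2 hd3 hd4
  omega

end PartData

namespace PartData
variable {G : Type*} [Group G] {D : PartData G}

/-! ### Exotic subgroups: pronormality -/

theorem zpowers_le_A (y : G) : Subgroup.zpowers y ≤ D.A y :=
  (Subgroup.zpowers_le).mpr (D.mem_self y)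

/-- In an exotic subgroup of order 12 there is a Sylow 3-subgroup equal to its normalizer. -/
theorem exotic12 [Finite G] {J : Subgroup G} (hE : D.Exotic J) (h12 : Nat.card J = 12) :
    (∀ y ∈ J, orderOf y = 3 → ∀ g ∈ J, g * y * g⁻¹ ∈ Subgroup.zpowers y → g ∈ Subgroup.zpowers y) ∧
    ∃ V ≤ J, Nat.card V = 4 ∧ ∀ g ∈ J, V.conjugate g = V := by
  have : Fact (Nat.Prime 3) := ⟨Nat.prime_three⟩
  have cardP : ∀ P : Sylow 3 J, Nat.card P = 3 := by
    intro P
    rw [P.card_eq_multiplicity, h12]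
    have : (12 : ℕ).factorization 3 = 1 := by
      rw [show (12 : ℕ) = 3 ^ 1 * 4 by norm_num,
        Nat.factorization_mul (by norm_num) (by norm_num), Nat.Prime.factorization_pow Nat.prime_three]
      simp [Nat.factorization_eq_zero_of_not_dvd]
    rw [this, pow_one]
  have hnorm : ∀ P : Sylow 3 J, Nat.card (Subgroup.normalizer (P : Set J)) = 3 := by
    intro P
    have h1 := P.card_eq_index_normalizer
    have h2 := card_sylow_modEq_one 3 J
    have h3 := Subgroup.card_mul_index (Subgroup.normalizer (P : Set J))
    have h4 : Nat.card P ∣ Nat.card (Subgroup.normalizer (P : Set J)) :=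
      Subgroup.card_dvd_of_le Subgroup.le_normalizer
    rw [cardP P] at h4
    obtain ⟨k, hk⟩ := h4
    rw [h12, hk, ← h1] at h3
    have h5 : k * Nat.card (Sylow 3 J) = 4 := by nlinarith
    have h6 : Nat.card (Sylow 3 J) ∣ 4 := ⟨k, by rw [mul_comm]; exact h5.symm⟩
    have h7 : Nat.card (Sylow 3 J) ≤ 4 := Nat.le_of_dvd (by norm_num) h6
    unfold Nat.ModEq at h2
    have h8 : Nat.card (Sylow 3 J) = 1 ∨ Nat.card (Sylow 3 J) = 4 := by omega
    rcases h8 with h8 | h8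
    · exfalso
      rw [h8] at h1
      have h9 := Subgroup.index_eq_one.mp h1.symm
      have : Nontrivial P := by
        rw [← Finite.one_lt_card_iff_nontrivial]
        have h10 : Nat.card P = 3 := cardP P
        omega
      obtain ⟨y, hy⟩ := exists_ne (1 : P)
      have hy1 : (y.1.1 : G) ≠ 1 := by
        intro h; apply hy; ext; simpa using h
      have hcyc : ∀ z : P, z ∈ Subgroup.zpowers y := by
        have hc := cardP P
        intro z
        exact mem_zpowers_of_prime_card (p := 3) hc hy
      apply hE _ hy1
      intro g hg
      rw [mem_N]
      have h10 : (⟨g, hg⟩ : J) ∈ Subgroup.normalizer (P : Set J) := by rw [h9]; trivial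
      have h11 := (Subgroup.mem_normalizer_iff.mp h10 y.1).mp y.2
      obtain ⟨k, hk⟩ := hcyc ⟨_, h11⟩
      have h12 := congrArg (fun z : P => (z.1.1 : G)) hk
      simp at h12
      rw [← h12]
      exact (D.A _).zpow_mem (D.mem_self _) k
    · rw [h8] at h5
      omega
  have heq : ∀ P : Sylow 3 J, Subgroup.normalizer (P : Set J) = P := by
    intro P
    exact (Subgroup.eq_of_le_of_card_ge Subgroup.le_normalizer
      ((hnorm P).le.trans (cardP P).ge)).symm
  constructor
  · intro y hy h3 g hg hgy
    have hP : IsPGroup 3 (Subgroup.zpowers (⟨y, hy⟩ : J)) := by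
      apply IsPGroup.of_card (n := 1)
      rw [Nat.card_zpowers, Subgroup.orderOf_mk, h3, pow_one]
    obtain ⟨P, hPle⟩ := hP.exists_le_sylow
    have hPe : Subgroup.zpowers (⟨y, hy⟩ : J) = P := by
      apply Subgroup.eq_of_le_of_card_ge hPle
      rw [Nat.card_zpowers, Subgroup.orderOf_mk, h3]
      exact (cardP P).le
    have hmem : (⟨g, hg⟩ : J) ∈ Subgroup.normalizer (P : Set J) := by
      apply Subgroup.mem_normalizer_fintype
      intro z hz
      have hz' : z ∈ Subgroup.zpowers (⟨y, hy⟩ : J) := by rw [hPe]; exact hz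
      obtain ⟨k, rfl⟩ := hz'
      obtain ⟨l, hl⟩ := hgy
      have e : (⟨g, hg⟩ : J) * ⟨y, hy⟩ ^ k * (⟨g, hg⟩ : J)⁻¹ = (⟨y, hy⟩ ^ l) ^ k := by
        ext
        simp only [Subgroup.coe_mul, Subgroup.coe_zpow, Subgroup.coe_inv]
        simp only at hl
        rw [hl, conj_zpow]
      have h5 : ((⟨y, hy⟩ : J) ^ l) ^ k ∈ Subgroup.zpowers (⟨y, hy⟩ : J) :=
        Subgroup.zpow_mem _ (Subgroup.zpow_mem _ (Subgroup.mem_zpowers _) _) _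
      rw [hPe] at h5
      show (⟨g, hg⟩ : J) * ⟨y, hy⟩ ^ k * (⟨g, hg⟩ : J)⁻¹ ∈ (P : Set J)
      rw [e]
      exact h5
    rw [heq P, ← hPe] at hmem
    obtain ⟨k, hk⟩ := hmem
    exact ⟨k, by simpa using congrArg (fun z : J => (z : G)) hk⟩
  · obtain ⟨P⟩ : Nonempty (Sylow 3 J) := inferInstance
    have hle : Subgroup.normalizer (P : Set J) ≤ Subgroup.centralizer (P : Set J) := by
      rw [heq P]
      have : IsCyclic P := isCyclic_of_prime_card (p := 3) (cardP P)
      intro a ha b hb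
      have h5 := (IsCyclic.commGroup (α := P)).mul_comm ⟨b, hb⟩ ⟨a, ha⟩
      exact congrArg (fun z : P => (z : J)) h5
    have hc := MonoidHom.ker_transferSylow_isComplement' P hle
    set K := (MonoidHom.transferSylow P hle).ker with hK
    have hKn : K.Normal := MonoidHom.normal_ker _
    clear_value K
    have hcard := hc.card_mul
    rw [h12] at hcard
    have h3 : Nat.card (P : Subgroup J) = 3 := cardP P
    rw [h3] at hcard
    refine ⟨K.map J.subtype, Subgroup.map_subtype_le _, ?_, ?_⟩
    · rw [Subgroup.card_map_of_injective J.subtype_injective]; omega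
    · intro g hg
      apply conjugate_eq_of_subset
      rintro _ ⟨k, hk, rfl⟩
      exact ⟨⟨g, hg⟩ * k * ⟨g, hg⟩⁻¹, hKn.conj_mem k hk _, by simp⟩


theorem exotic60 [Finite G] {J L V : Subgroup G} (hL : Nat.card L = 60)
    (hN : ∀ x (hx : x ≠ 1), x ∈ L → Nat.card (L ⊓ D.N x hx : Subgroup G) ≤ 10)
    (hJ : Nat.card J = 12) (hJL : J ≤ L) (hV : Nat.card V = 4) (hVL : V ≤ L)
    (hVJ : ∀ g ∈ J, V.conjugate g = V) : ∀ h ∈ L, V.conjugate h = V → h ∈ J := by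
  classical
  have := Fintype.ofFinite G
  set M : Subgroup G :=
    { carrier := {h | h ∈ L ∧ V.conjugate h = V}
      one_mem' := ⟨L.one_mem, conjugate_one V⟩
      mul_mem' := by
        rintro a b ⟨ha, ha'⟩ ⟨hb, hb'⟩
        exact ⟨L.mul_mem ha hb, by rw [conjugate_mul, ha', hb']⟩
      inv_mem' := by
        rintro a ⟨ha, ha'⟩
        exact ⟨L.inv_mem ha, conjugate_inv_eq ha'⟩ } with hM
  have hML : M ≤ L := fun h hh => hh.1
  have hJM : J ≤ M := fun h hh => ⟨hJL hh, hVJ h hh⟩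
  have d1 : Nat.card J ∣ Nat.card M := Subgroup.card_dvd_of_le hJM
  have d2 : Nat.card M ∣ Nat.card L := Subgroup.card_dvd_of_le hML
  rw [hJ] at d1
  rw [hL] at d2
  have hM12 : Nat.card M = 12 := by
    obtain ⟨k, hk⟩ := d1
    rw [hk] at d2
    have hk5 : k ∣ 5 := by
      have : 12 * k ∣ 12 * 5 := d2
      exact Nat.dvd_of_mul_dvd_mul_left (by norm_num) this
    rcases (Nat.dvd_prime (by norm_num)).mp hk5 with rfl | rfl
    · omega
    exfalso
    have hLM : L ≤ M := (Subgroup.eq_of_le_of_card_ge hML (by rw [hL, hk])).ge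
    have hVne : V ≠ ⊥ := by
      rintro rfl
      simp at hV
    obtain ⟨t, htV, ht1⟩ := exists_ne_one_mem hVne
    have key := Finset.card_le_mul_card_image_of_maps_to (f := fun g => g * t * g⁻¹)
      (s := Finset.univ.filter (· ∈ L)) (t := (Finset.univ.filter (· ∈ V)).erase 1) (by
        intro g hg
        simp only [Finset.mem_filter, Finset.mem_univ, true_and] at hg
        simp only [Finset.mem_erase, Finset.mem_filter, Finset.mem_univ, true_and]
        refine ⟨conj_ne_one g ht1, ?_⟩
        have := (hLM hg).2
        rw [← this] at htV
        exact mem_conjugate.mp htV) 10 (by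
        intro b hb
        by_cases hne : ({a ∈ Finset.univ.filter (· ∈ L) | a * t * a⁻¹ = b} : Finset G).Nonempty
        · obtain ⟨a0, ha0⟩ := hne
          simp only [Finset.mem_filter, Finset.mem_univ, true_and] at ha0
          refine le_trans ?_ (hN t ht1 (hVL htV))
          rw [← card_sub (L ⊓ D.N t ht1) (Finset.univ.filter (· ∈ L ⊓ D.N t ht1)) (by simp)]
          refine Finset.card_le_card_of_injOn (fun a => a0⁻¹ * a) ?_ ?_
          · intro a ha
            simp only [Finset.coe_filter, Finset.mem_filter, Finset.mem_univ, true_and,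
              Set.mem_ofPred_eq, Subgroup.mem_inf] at ha ⊢
            refine ⟨L.mul_mem (L.inv_mem ha0.1) ha.1, ?_⟩
            rw [mem_N]
            have e : a0⁻¹ * a * t * (a0⁻¹ * a)⁻¹ = t := by
              have : a0⁻¹ * a * t * (a0⁻¹ * a)⁻¹ = a0⁻¹ * (a * t * a⁻¹) * a0 := by group
              rw [this, ha.2, ← ha0.2]; group
            rw [e]; exact D.mem_self t
          · intro a _ b _ h
            exact mul_left_cancel h
        · rw [Finset.not_nonempty_iff_eq_empty] at hne
          rw [hne]; simp)
    rw [card_sub L _ (by simp), Finset.card_erase_of_mem (by simp),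
      card_sub V _ (by simp), hL, hV] at key
    norm_num at key
  have hJeq := Subgroup.eq_of_le_of_card_ge hJM (by rw [hM12, hJ])
  intro h hh hhV
  rw [hJeq]
  exact ⟨hh, hhV⟩

theorem exotic24 [Finite G] {J J' L : Subgroup G} (hL : Nat.card L = 24)
    (hJ : Nat.card J = 12) (hJ' : Nat.card J' = 12) (hJL : J ≤ L) (hJL' : J' ≤ L)
    (h3 : ∀ y ∈ J, orderOf y = 3 → ∀ g ∈ J, g * y * g⁻¹ ∈ Subgroup.zpowers y →
      g ∈ Subgroup.zpowers y) : J = J' := by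
  by_contra hne
  have hi' : (J'.subgroupOf L).index = 2 := by
    have := Subgroup.card_mul_index (J'.subgroupOf L)
    rw [Nat.card_congr (Subgroup.subgroupOfEquivOfLe hJL').toEquiv, hJ', hL] at this
    omega
  set M := J ⊓ J' with hM
  have hnle : ¬ J ≤ J' := fun h => hne (Subgroup.eq_of_le_of_card_ge h (by rw [hJ, hJ']))
  rw [SetLike.not_le_iff_exists] at hnle
  obtain ⟨t, ht, htJ'⟩ := hnle
  have mulmem : ∀ a b, a ∈ L → b ∈ L → (a * b ∈ J' ↔ (a ∈ J' ↔ b ∈ J')) := by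
    intro a b ha hb
    have := Subgroup.mul_mem_iff_of_index_two hi' (a := ⟨a, ha⟩) (b := ⟨b, hb⟩)
    simpa [Subgroup.mem_subgroupOf] using this
  have hMi : (M.subgroupOf J).index = 2 := by
    rw [Subgroup.index_eq_two_iff]
    refine ⟨⟨t, ht⟩, ?_⟩
    rintro ⟨b, hb⟩
    simp only [Subgroup.mem_subgroupOf, Subgroup.coe_mul, hM, Subgroup.mem_inf, hb, true_and,
      J.mul_mem hb ht]
    rw [mulmem b t (hJL hb) (hJL ht)]
    unfold Xor
    tauto
  have hMc : Nat.card M = 6 := by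
    have := Subgroup.card_mul_index (M.subgroupOf J)
    rw [Nat.card_congr (Subgroup.subgroupOfEquivOfLe (inf_le_left : M ≤ J)).toEquiv, hMi, hJ] at this
    change Nat.card M * 2 = 12 at this
    omega
  have : Fact (Nat.Prime 3) := ⟨Nat.prime_three⟩
  obtain ⟨y, hy⟩ := exists_prime_orderOf_dvd_card' (G := M) 3 (by rw [hMc]; norm_num)
  have hy3 : orderOf (y : G) = 3 := by rw [Subgroup.orderOf_coe]; exact hy
  have hP : (Subgroup.zpowers y).index = 2 := by
    have := Subgroup.card_mul_index (Subgroup.zpowers y)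
    rw [Nat.card_zpowers, hy, hMc] at this
    omega
  have hn := Subgroup.normal_of_index_eq_two hP
  have hle : M ≤ Subgroup.zpowers (y : G) := by
    intro g hg
    refine h3 y y.2.1 hy3 g hg.1 ?_
    obtain ⟨k, hk⟩ := hn.conj_mem y (Subgroup.mem_zpowers y) ⟨g, hg⟩
    exact ⟨k, by simpa using congrArg (fun z : M => (z : G)) hk⟩
  have := Subgroup.card_le_of_le hle
  rw [Nat.card_zpowers, hy3, hMc] at this
  omega

theorem exotic_main [Finite G] {J : Subgroup G} (hE : D.Exotic J) : IsPronormal J := by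
  by_cases hb : J = ⊥
  · rw [hb]; exact isPronormal_bot
  obtain ⟨x, hxJ, hx⟩ := exists_ne_one_mem hb
  rcases exotic_NF hE with hNF | htop
  swap
  · rw [htop]; exact isPronormal_top
  intro g
  set L := J ⊔ J.conjugate g with hLdef
  have hJL : J ≤ L := le_sup_left
  have hJL' : J.conjugate g ≤ L := le_sup_right
  have hEL := exotic_mono hE hJL
  rcases exotic_NF hEL with hNFL | htop
  swap
  · exact ⟨g, by rw [htop]; trivial, rfl⟩
  have hdvd : Nat.card J ∣ Nat.card L := Subgroup.card_dvd_of_le hJL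
  have hcJ := exotic_card hE hNF hx hxJ
  have hcL := exotic_card hEL hNFL hx (hJL hxJ)
  by_cases heq : Nat.card J = Nat.card L
  · refine ⟨1, L.one_mem, ?_⟩
    rw [conjugate_one, Subgroup.eq_of_le_of_card_ge hJL heq.ge]
    symm
    rw [← Subgroup.eq_of_le_of_card_ge hJL heq.ge]
    rw [Subgroup.eq_of_le_of_card_ge hJL' (by rw [card_conjugate, heq]),
      Subgroup.eq_of_le_of_card_ge hJL heq.ge]
  have hJ12 : Nat.card J = 12 := by
    rcases hcJ with h | h | ⟨h, -⟩ <;> rcases hcL with h' | h' | ⟨h', -⟩ <;>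
      rw [h, h'] at hdvd <;> revert hdvd <;> omega
  obtain ⟨h3, V, hVJ, hV4, hVn⟩ := exotic12 hE hJ12
  rcases hcL with h' | h' | ⟨h', -⟩
  · omega
  · refine ⟨1, L.one_mem, ?_⟩
    rw [conjugate_one]
    exact exotic24 h' hJ12 (by rw [card_conjugate, hJ12]) hJL hJL' h3
  · have hN : ∀ x (hx : x ≠ 1), x ∈ L → Nat.card (L ⊓ D.N x hx : Subgroup G) ≤ 10 := by
      intro x hx hxL
      have := exotic_card hEL hNFL hx hxL
      omega
    have h60 := exotic60 (D := D) h' hN hJ12 hJL hV4 (hVJ.trans hJL) hVn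
    have : Fact (Nat.Prime 2) := ⟨Nat.prime_two⟩
    have p1 : IsPGroup 2 V := IsPGroup.of_card (n := 2) (by rw [hV4]; norm_num)
    have p2 : IsPGroup 2 (V.conjugate g) :=
      IsPGroup.of_card (n := 2) (by rw [card_conjugate, hV4]; norm_num)
    obtain ⟨w, hw, R, hRL, hR, hVR, hVR'⟩ := sylow_conj p1 p2 (hVJ.trans hJL)
      ((conjugate_mono hVJ g).trans hJL')
    have hR4 : Nat.card R ≤ 4 := by
      obtain ⟨k, hk⟩ := IsPGroup.iff_card.mp hR
      have d : Nat.card R ∣ Nat.card L := Subgroup.card_dvd_of_le hRL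
      rw [h', hk] at d
      rw [hk]
      have hk2 : k ≤ 2 := by
        by_contra hk3
        have : 2 ^ 3 ∣ 2 ^ k := Nat.pow_dvd_pow 2 (by omega)
        have := this.trans d
        omega
      exact (Nat.pow_le_pow_right (by norm_num) hk2).trans (by norm_num)
    have e1 := Subgroup.eq_of_le_of_card_ge hVR (by rw [card_conjugate, hV4]; exact hR4)
    have e2 := Subgroup.eq_of_le_of_card_ge hVR' (by rw [card_conjugate, hV4]; exact hR4)
    refine ⟨w, hw, ?_⟩
    symm
    apply Subgroup.eq_of_le_of_card_ge
    · intro h hh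
      rw [mem_conjugate]
      apply h60
      · exact L.mul_mem (L.mul_mem hw (hJL' hh)) (L.inv_mem hw)
      · rw [conjugate_mul, conjugate_mul, e1, ← e2]
        rw [mem_conjugate] at hh
        have e3 : (V.conjugate g).conjugate h = V.conjugate g := by
          have := hVn _ hh
          rw [← conjugate_mul]
          have e4 : g * h = g * h * g⁻¹ * g := by group
          rw [e4, conjugate_mul, this]
        rw [e3, e2]
        exact conjugate_inv_eq e1
    · rw [card_conjugate, card_conjugate]

theorem main [Finite G] (D : PartData G) {H K : Subgroup G}
    (hHp : IsPronormal H) (hKp : IsPronormal K) : IsPronormal (H ⊔ K) := by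
  by_cases h : ∃ x, ∃ hx : x ≠ 1, H ⊔ K ≤ D.N x hx
  · obtain ⟨x, hx, h⟩ := h
    exact N_main hx hHp hKp h
  · push Not at h
    exact exotic_main (D := D) h

end PartData

namespace PSLtwo
variable {F : Type*} [Field F]

/-! ### Two by two matrices -/

/-- Abbreviation for the special linear group. -/
abbrev SLt (F : Type*) [Field F] := Matrix.SpecialLinearGroup (Fin 2) F
/-- Abbreviation for the projective special linear group. -/
abbrev PSLt (F : Type*) [Field F] := Matrix.ProjectiveSpecialLinearGroup (Fin 2) F

/-- The quotient map. -/
def pr : SLt F →* PSLt F := QuotientGroup.mk' _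

theorem pr_surj : Function.Surjective (pr : SLt F →* PSLt F) := QuotientGroup.mk'_surjective _

/-- A matrix from its entries. -/
def mat (a b c d : F) (h : a * d - b * c = 1) : SLt F :=
  ⟨!![a, b; c, d], by rw [Matrix.det_fin_two_of]; exact h⟩

@[simp] theorem mat00 (a b c d : F) (h) : (mat a b c d h).1 0 0 = a := rfl
@[simp] theorem mat01 (a b c d : F) (h) : (mat a b c d h).1 0 1 = b := rfl
@[simp] theorem mat10 (a b c d : F) (h) : (mat a b c d h).1 1 0 = c := rfl
@[simp] theorem mat11 (a b c d : F) (h) : (mat a b c d h).1 1 1 = d := rfl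

theorem det_eq (X : SLt F) : X.1 0 0 * X.1 1 1 - X.1 0 1 * X.1 1 0 = 1 := by
  have := X.2
  rwa [Matrix.det_fin_two] at this

theorem ext4 {X Y : SLt F} (h1 : X.1 0 0 = Y.1 0 0) (h2 : X.1 0 1 = Y.1 0 1)
    (h3 : X.1 1 0 = Y.1 1 0) (h4 : X.1 1 1 = Y.1 1 1) : X = Y := by
  apply Matrix.SpecialLinearGroup.ext
  intro i j
  fin_cases i <;> fin_cases j <;> assumption

@[simp] theorem mul00 (X Y : SLt F) : (X * Y).1 0 0 = X.1 0 0 * Y.1 0 0 + X.1 0 1 * Y.1 1 0 := by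
  show (X.1 * Y.1) 0 0 = _
  simp [Matrix.mul_apply, Fin.sum_univ_two]
@[simp] theorem mul01 (X Y : SLt F) : (X * Y).1 0 1 = X.1 0 0 * Y.1 0 1 + X.1 0 1 * Y.1 1 1 := by
  show (X.1 * Y.1) 0 1 = _
  simp [Matrix.mul_apply, Fin.sum_univ_two]
@[simp] theorem mul10 (X Y : SLt F) : (X * Y).1 1 0 = X.1 1 0 * Y.1 0 0 + X.1 1 1 * Y.1 1 0 := by
  show (X.1 * Y.1) 1 0 = _
  simp [Matrix.mul_apply, Fin.sum_univ_two]
@[simp] theorem mul11 (X Y : SLt F) : (X * Y).1 1 1 = X.1 1 0 * Y.1 0 1 + X.1 1 1 * Y.1 1 1 := by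
  show (X.1 * Y.1) 1 1 = _
  simp [Matrix.mul_apply, Fin.sum_univ_two]
@[simp] theorem one00 : (1 : SLt F).1 0 0 = 1 := rfl
@[simp] theorem one01 : (1 : SLt F).1 0 1 = 0 := rfl
@[simp] theorem one10 : (1 : SLt F).1 1 0 = 0 := rfl
@[simp] theorem one11 : (1 : SLt F).1 1 1 = 1 := rfl

theorem inv_eq (X : SLt F) : X⁻¹ = mat (X.1 1 1) (-X.1 0 1) (-X.1 1 0) (X.1 0 0)
    (by have := det_eq X; linear_combination this) := by
  rw [inv_eq_iff_mul_eq_one]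
  have := det_eq X
  apply ext4 <;> simp
  · linear_combination this
  · ring
  · ring
  · linear_combination this

@[simp] theorem inv00 (X : SLt F) : (X⁻¹).1 0 0 = X.1 1 1 := by rw [inv_eq]; rfl
@[simp] theorem inv01 (X : SLt F) : (X⁻¹).1 0 1 = -X.1 0 1 := by rw [inv_eq]; rfl
@[simp] theorem inv10 (X : SLt F) : (X⁻¹).1 1 0 = -X.1 1 0 := by rw [inv_eq]; rfl
@[simp] theorem inv11 (X : SLt F) : (X⁻¹).1 1 1 = X.1 0 0 := by rw [inv_eq]; rfl

/-- The negative. -/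
def ng (X : SLt F) : SLt F := mat (-X.1 0 0) (-X.1 0 1) (-X.1 1 0) (-X.1 1 1)
    (by have := det_eq X; linear_combination this)

/-- Scalar matrices. -/
def Sc (X : SLt F) : Prop := X.1 0 1 = 0 ∧ X.1 1 0 = 0 ∧ X.1 0 0 = X.1 1 1

/-- The trace. -/
def tr (X : SLt F) : F := X.1 0 0 + X.1 1 1

theorem sc_center {X : SLt F} : X ∈ Subgroup.center (SLt F) ↔ Sc X := by
  rw [Subgroup.mem_center_iff]
  constructor
  · intro h
    have h1 := h (mat 1 1 0 1 (by ring))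
    have h2 := h (mat 1 0 1 1 (by ring))
    have e1 := congrArg (fun Z : SLt F => Z.1 0 0) h1
    have e2 := congrArg (fun Z : SLt F => Z.1 0 1) h1
    have e3 := congrArg (fun Z : SLt F => Z.1 0 0) h2
    simp at e1 e2 e3
    refine ⟨e3, e1, ?_⟩
    linear_combination -e2
  · rintro ⟨h1, h2, h3⟩ Y
    apply ext4 <;> simp [h1, h2, h3] <;> ring

theorem sc_one_or {X : SLt F} (h : Sc X) : X = 1 ∨ X = ng 1 := by
  obtain ⟨h1, h2, h3⟩ := h
  have hd := det_eq X
  rw [h1, h3] at hd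
  have : (X.1 1 1 - 1) * (X.1 1 1 + 1) = 0 := by linear_combination hd
  rcases mul_eq_zero.mp this with h | h
  · left; apply ext4 <;> simp [h1, h2, h3] <;> linear_combination h
  · right; apply ext4 <;> simp [h1, h2, h3, ng] <;> linear_combination h

theorem sc_ng_one : Sc (ng (1 : SLt F)) := by simp [Sc, ng]
theorem sc_one : Sc (1 : SLt F) := by simp [Sc]

theorem ng_eq_mul (X : SLt F) : ng X = X * ng 1 := by
  apply ext4 <;> simp [ng]

theorem pr_eq_one {X : SLt F} : pr X = 1 ↔ Sc X := by
  rw [← sc_center]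
  exact QuotientGroup.eq_one_iff X

theorem pr_eq {X Y : SLt F} : pr X = pr Y ↔ Y = X ∨ Y = ng X := by
  constructor
  · intro h
    have h1 : pr (X⁻¹ * Y) = 1 := by rw [map_mul, map_inv, h, inv_mul_cancel]
    rw [pr_eq_one] at h1
    rcases sc_one_or h1 with h | h
    · left; rw [inv_mul_eq_one] at h; exact h.symm
    · right; rw [ng_eq_mul, ← h]; group
  · rintro (rfl | rfl)
    · rfl
    · rw [ng_eq_mul, map_mul, pr_eq_one.mpr sc_ng_one, mul_one]

theorem pr_ng (X : SLt F) : pr (ng X) = pr X := (pr_eq.mpr (Or.inr rfl)).symm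

/-! ### Commuting -/

theorem param {X Y : SLt F} (hX : ¬ Sc X) (h : X * Y = Y * X) : ∃ a b : F,
    Y.1 0 0 = a + b * X.1 0 0 ∧ Y.1 0 1 = b * X.1 0 1 ∧ Y.1 1 0 = b * X.1 1 0 ∧
    Y.1 1 1 = a + b * X.1 1 1 := by
  have e1 := congrArg (fun Z : SLt F => Z.1 0 0) h
  have e2 := congrArg (fun Z : SLt F => Z.1 0 1) h
  have e3 := congrArg (fun Z : SLt F => Z.1 1 0) h
  simp only [mul00, mul01, mul10] at e1 e2 e3
  by_cases h1 : X.1 0 1 = 0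
  · by_cases h2 : X.1 1 0 = 0
    · have h3 : X.1 0 0 - X.1 1 1 ≠ 0 := fun h3 => hX ⟨h1, h2, by linear_combination h3⟩
      simp only [h1, h2] at e2 e3 ⊢
      refine ⟨Y.1 0 0 - (Y.1 0 0 - Y.1 1 1) / (X.1 0 0 - X.1 1 1) * X.1 0 0,
        (Y.1 0 0 - Y.1 1 1) / (X.1 0 0 - X.1 1 1), by ring, ?_, ?_, ?_⟩
      · apply mul_left_cancel₀ h3; linear_combination e2
      · apply mul_left_cancel₀ h3; linear_combination -e3
      · field_simp; ring
    · refine ⟨Y.1 0 0 - Y.1 1 0 / X.1 1 0 * X.1 0 0, Y.1 1 0 / X.1 1 0, by ring, ?_, ?_, ?_⟩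
      · field_simp; linear_combination -e1
      · field_simp
      · field_simp; linear_combination -e3
  · refine ⟨Y.1 0 0 - Y.1 0 1 / X.1 0 1 * X.1 0 0, Y.1 0 1 / X.1 0 1, by ring, ?_, ?_, ?_⟩
    · field_simp
    · field_simp; linear_combination e1
    · field_simp; linear_combination e2

theorem comm_of_param {X Y Z : SLt F} {a b c d : F} (h1 : Y.1 0 0 = a + b * X.1 0 0)
    (h2 : Y.1 0 1 = b * X.1 0 1) (h3 : Y.1 1 0 = b * X.1 1 0) (h4 : Y.1 1 1 = a + b * X.1 1 1)
    (k1 : Z.1 0 0 = c + d * X.1 0 0)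
    (k2 : Z.1 0 1 = d * X.1 0 1) (k3 : Z.1 1 0 = d * X.1 1 0) (k4 : Z.1 1 1 = c + d * X.1 1 1) :
    Y * Z = Z * Y := by
  apply ext4 <;> simp [h1, h2, h3, h4, k1, k2, k3, k4] <;> ring

theorem comm_trans {X Y Z : SLt F} (hX : ¬ Sc X) (hY : X * Y = Y * X) (hZ : X * Z = Z * X) :
    Y * Z = Z * Y := by
  obtain ⟨a, b, h1, h2, h3, h4⟩ := param hX hY
  obtain ⟨c, d, k1, k2, k3, k4⟩ := param hX hZ
  exact comm_of_param h1 h2 h3 h4 k1 k2 k3 k4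

theorem comm_of_sc {X Y : SLt F} (h : Sc X) : X * Y = Y * X := by
  obtain ⟨h1, h2, h3⟩ := h
  apply ext4 <;> simp [h1, h2, h3] <;> ring

/-- The image of the centralizer of a lift. -/
noncomputable def A (x : PSLt F) : Subgroup (PSLt F) :=
  (Subgroup.centralizer {Function.surjInv pr_surj x}).map pr

/-- Semisimple elements. -/
def S (x : PSLt F) : Prop := tr (Function.surjInv pr_surj x) ^ 2 ≠ 4

theorem mul_ng {X Y : SLt F} : X * ng Y = ng (X * Y) := by
  apply ext4 <;> simp [ng] <;> ring
theorem ng_mul {X Y : SLt F} : ng X * Y = ng (X * Y) := by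
  apply ext4 <;> simp [ng] <;> ring
theorem ng_ng (X : SLt F) : ng (ng X) = X := by
  apply ext4 <;> simp [ng]
theorem ng_inj {X Y : SLt F} : ng X = ng Y ↔ X = Y :=
  ⟨fun h => by rw [← ng_ng X, h, ng_ng], fun h => by rw [h]⟩

theorem out_eq (X : SLt F) : Function.surjInv pr_surj (pr X) = X ∨
    Function.surjInv pr_surj (pr X) = ng X :=
  pr_eq.mp (Function.surjInv_eq pr_surj (pr X)).symm

theorem mem_A {X Y : SLt F} : pr Y ∈ A (pr X) ↔ X * Y = Y * X := by
  unfold A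
  rw [Subgroup.mem_map]
  constructor
  · rintro ⟨Z, hZ, hZY⟩
    rw [Subgroup.mem_centralizer_singleton_iff] at hZ
    rcases out_eq X with h | h <;> rw [h] at hZ <;> rcases pr_eq.mp hZY with rfl | rfl <;>
      (try simp only [mul_ng, ng_mul, ng_inj] at hZ ⊢) <;> exact hZ.symm
  · intro h
    refine ⟨Y, ?_, rfl⟩
    rw [Subgroup.mem_centralizer_singleton_iff]
    rcases out_eq X with h' | h' <;> rw [h'] <;> (try simp only [mul_ng, ng_mul, ng_inj]) <;>
      exact h.symm

theorem S_pr {X : SLt F} : S (pr X) ↔ tr X ^ 2 ≠ 4 := by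
  unfold S
  rcases out_eq X with h | h <;> rw [h]
  have : tr (ng X) ^ 2 = tr X ^ 2 := by simp [tr, ng]; ring
  rw [this]

theorem tr_conj (G X : SLt F) : tr (G * X * G⁻¹) = tr X := by
  have := det_eq G
  simp [tr]
  linear_combination (X.1 0 0 + X.1 1 1) * this

end PSLtwo

namespace PSLtwo
variable {F : Type*} [Field F]

/-! ### Verification of the properties: semisimple part -/

theorem sc_iff_ne {X : SLt F} : pr X ≠ 1 ↔ ¬ Sc X := not_congr pr_eq_one

theorem conj_comm {G X Y : SLt F} (h : X * Y = Y * X) :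
    (G * X * G⁻¹) * (G * Y * G⁻¹) = (G * Y * G⁻¹) * (G * X * G⁻¹) := by
  have e1 : (G * X * G⁻¹) * (G * Y * G⁻¹) = G * (X * Y) * G⁻¹ := by group
  have e2 : (G * Y * G⁻¹) * (G * X * G⁻¹) = G * (Y * X) * G⁻¹ := by group
  rw [e1, e2, h]

theorem ax_mem_self (x : PSLt F) : x ∈ A x := by
  obtain ⟨X, rfl⟩ := pr_surj x
  rw [mem_A]

theorem ax_A_eq {x y : PSLt F} (hx : x ≠ 1) (hy : y ∈ A x) (hy1 : y ≠ 1) : A y = A x := by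
  obtain ⟨X, rfl⟩ := pr_surj x
  obtain ⟨Y, rfl⟩ := pr_surj y
  rw [mem_A] at hy
  rw [sc_iff_ne] at hx hy1
  ext z
  obtain ⟨Z, rfl⟩ := pr_surj z
  rw [mem_A, mem_A]
  exact ⟨fun h => comm_trans hy1 hy.symm h, fun h => comm_trans hx hy h⟩

theorem ax_A_conj {x y : PSLt F} (g : PSLt F) (hy : y ∈ A x) : g * y * g⁻¹ ∈ A (g * x * g⁻¹) := by
  obtain ⟨X, rfl⟩ := pr_surj x
  obtain ⟨Y, rfl⟩ := pr_surj y
  obtain ⟨G, rfl⟩ := pr_surj g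
  rw [mem_A] at hy
  rw [← map_inv, ← map_mul, ← map_mul, ← map_mul, ← map_mul, mem_A]
  exact conj_comm hy

theorem ax_A_comm {x y z : PSLt F} (hx : x ≠ 1) (hy : y ∈ A x) (hz : z ∈ A x) :
    y * z = z * y := by
  obtain ⟨X, rfl⟩ := pr_surj x
  obtain ⟨Y, rfl⟩ := pr_surj y
  obtain ⟨Z, rfl⟩ := pr_surj z
  rw [mem_A] at hy hz
  rw [← map_mul, ← map_mul, comm_trans (sc_iff_ne.mp hx) hy hz]

theorem disc_eq (X : SLt F) : tr X ^ 2 - 4 = (X.1 0 0 - X.1 1 1) ^ 2 + 4 * (X.1 0 1 * X.1 1 0) := by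
  have := det_eq X
  simp only [tr]
  linear_combination 4 * this

theorem disc_param {X Y : SLt F} {a b : F} (h1 : Y.1 0 0 = a + b * X.1 0 0)
    (h2 : Y.1 0 1 = b * X.1 0 1) (h3 : Y.1 1 0 = b * X.1 1 0) (h4 : Y.1 1 1 = a + b * X.1 1 1) :
    tr Y ^ 2 - 4 = b ^ 2 * (tr X ^ 2 - 4) := by
  rw [disc_eq, disc_eq, h1, h2, h3, h4]; ring

theorem ax_S_of_mem {x y : PSLt F} (hx : x ≠ 1) (hS : S x) (hy : y ∈ A x) (hy1 : y ≠ 1) : S y := by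
  obtain ⟨X, rfl⟩ := pr_surj x
  obtain ⟨Y, rfl⟩ := pr_surj y
  rw [mem_A] at hy
  rw [sc_iff_ne] at hx hy1
  rw [S_pr, ← sub_ne_zero] at hS ⊢
  obtain ⟨a, b, h1, h2, h3, h4⟩ := param hx hy
  rw [disc_param h1 h2 h3 h4]
  refine mul_ne_zero (pow_ne_zero 2 ?_) hS
  rintro rfl
  apply hy1
  refine ⟨by rw [h2]; ring, by rw [h3]; ring, by rw [h1, h4]; ring⟩

theorem ax_S_conj {x : PSLt F} (g : PSLt F) (hS : S x) : S (g * x * g⁻¹) := by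
  obtain ⟨X, rfl⟩ := pr_surj x
  obtain ⟨G, rfl⟩ := pr_surj g
  rw [S_pr] at hS
  rwa [← map_inv, ← map_mul, ← map_mul, S_pr, tr_conj]

/-- Elements normalizing but not centralizing a torus invert it. -/
theorem inv_lemma {X G : SLt F} (hX : ¬ Sc X) (hS : tr X ^ 2 ≠ 4)
    (h : X * (G * X * G⁻¹) = (G * X * G⁻¹) * X) (hG : ¬ X * G = G * X) : G * X * G⁻¹ = X⁻¹ := by
  obtain ⟨a, b, h1, h2, h3, h4⟩ := param hX h
  have hd := disc_param h1 h2 h3 h4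
  rw [tr_conj] at hd
  rw [← sub_ne_zero] at hS
  have hb : b ^ 2 = 1 := by
    have : (b ^ 2 - 1) * (tr X ^ 2 - 4) = 0 := by linear_combination -hd
    rcases mul_eq_zero.mp this with h | h
    · linear_combination h
    · exact absurd h hS
  have ht : 2 * a + b * tr X = tr X := by
    have := tr_conj G X
    unfold tr at this ⊢
    rw [h1, h4] at this
    linear_combination this
  have hdet : a * (a + b * tr X) = 0 := by
    have e1 := det_eq (G * X * G⁻¹)
    have e2 := det_eq X
    rw [h1, h2, h3, h4] at e1
    unfold tr
    linear_combination e1 - b ^ 2 * e2 - hb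
  have hne : ¬ (a = 0 ∧ b = 1) := by
    rintro ⟨rfl, rfl⟩
    apply hG
    have : G * X * G⁻¹ = X := by apply ext4 <;> simp only [h1, h2, h3, h4] <;> ring
    rw [mul_inv_eq_iff_eq_mul] at this
    exact this.symm
  have key : a = tr X ∧ b = -1 := by
    have hb' : (b - 1) * (b + 1) = 0 := by linear_combination hb
    rcases mul_eq_zero.mp hb' with hb1 | hb1
    · have hb1 : b = 1 := by linear_combination hb1
      subst hb1
      have ha : a ≠ 0 := fun h => hne ⟨h, rfl⟩
      have h2 : (2 : F) = 0 := by
        have : a * 2 = 0 := by linear_combination ht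
        rcases mul_eq_zero.mp this with h | h
        · exact absurd h ha
        · exact h
      rcases mul_eq_zero.mp hdet with h | h
      · exact absurd h ha
      · exact ⟨by linear_combination h - tr X * h2, by linear_combination h2⟩
    · have hb1 : b = -1 := by linear_combination hb1
      subst hb1
      refine ⟨?_, rfl⟩
      rcases mul_eq_zero.mp hdet with h | h
      · by_cases h2 : (2 : F) = 0
        · exact absurd ⟨h, by linear_combination -h2⟩ hne
        · have : 2 * (a - tr X) = 0 := by linear_combination ht
          rcases mul_eq_zero.mp this with h' | h'
          · exact absurd h' h2
          · linear_combination h'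
      · linear_combination h
  obtain ⟨rfl, rfl⟩ := key
  apply ext4
  · rw [h1, inv00]; simp [tr]
  · rw [h2, inv01]; ring
  · rw [h3, inv10]; ring
  · rw [h4, inv11]; simp [tr]

theorem inv_all {X Y G : SLt F} (hX : ¬ Sc X) (hY : X * Y = Y * X) (h : G * X * G⁻¹ = X⁻¹) :
    G * Y * G⁻¹ = Y⁻¹ := by
  obtain ⟨a, b, h1, h2, h3, h4⟩ := param hX hY
  rw [mul_inv_eq_iff_eq_mul] at h ⊢
  have e1 := congrArg (fun Z : SLt F => Z.1 0 0) h
  have e2 := congrArg (fun Z : SLt F => Z.1 0 1) h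
  have e3 := congrArg (fun Z : SLt F => Z.1 1 0) h
  have e4 := congrArg (fun Z : SLt F => Z.1 1 1) h
  simp only [mul00, mul01, mul10, mul11, inv00, inv01, inv10, inv11] at e1 e2 e3 e4
  apply ext4 <;> simp only [mul00, mul01, mul10, mul11, inv00, inv01, inv10, inv11, h1, h2, h3, h4]
  · linear_combination b * e1
  · linear_combination b * e2
  · linear_combination b * e3
  · linear_combination b * e4

theorem ax_S_inv {x g : PSLt F} (hx : x ≠ 1) (hS : S x) (h : g * x * g⁻¹ ∈ A x) (hg : g ∉ A x) :
    (∀ y ∈ A x, g * y * g⁻¹ = y⁻¹) ∧ g * g = 1 := by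
  obtain ⟨X, rfl⟩ := pr_surj x
  obtain ⟨G, rfl⟩ := pr_surj g
  rw [sc_iff_ne] at hx
  rw [S_pr] at hS
  rw [← map_inv, ← map_mul, ← map_mul, mem_A] at h
  rw [mem_A] at hg
  have hi := inv_lemma hx hS h hg
  constructor
  · intro y hy
    obtain ⟨Y, rfl⟩ := pr_surj y
    rw [mem_A] at hy
    rw [← map_inv, ← map_mul, ← map_mul, ← map_inv, inv_all hx hy hi]
  · rw [← map_mul, pr_eq_one]
    by_contra hsc
    apply hg
    refine comm_trans hsc ?_ (by group)
    rw [mul_inv_eq_iff_eq_mul] at hi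
    have h2 : G * X⁻¹ = X * G := by
      rw [mul_inv_eq_iff_eq_mul]
      have : X * G * X = X * (X⁻¹ * G) := by rw [mul_assoc, hi]
      rw [this]; group
    rw [mul_assoc, hi, ← mul_assoc, h2, mul_assoc]

theorem ax_S_mul {x g k : PSLt F} (hx : x ≠ 1) (hS : S x) (h : g * x * g⁻¹ ∈ A x) (hg : g ∉ A x)
    (h' : k * x * k⁻¹ ∈ A x) (hk : k ∉ A x) : g * k ∈ A x := by
  obtain ⟨X, rfl⟩ := pr_surj x
  obtain ⟨G, rfl⟩ := pr_surj g
  obtain ⟨K, rfl⟩ := pr_surj k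
  rw [sc_iff_ne] at hx
  rw [S_pr] at hS
  rw [← map_inv, ← map_mul, ← map_mul, mem_A] at h h'
  rw [mem_A] at hg hk
  have hi := inv_lemma hx hS h hg
  have hi' := inv_lemma hx hS h' hk
  rw [← map_mul, mem_A]
  have e : G * X⁻¹ * G⁻¹ = X := by
    have : G * X⁻¹ * G⁻¹ = (G * X * G⁻¹)⁻¹ := by group
    rw [this, hi, inv_inv]
  have e2 : (G * K) * X * (G * K)⁻¹ = X := by
    have : (G * K) * X * (G * K)⁻¹ = G * (K * X * K⁻¹) * G⁻¹ := by group
    rw [this, hi', e]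
  rw [mul_inv_eq_iff_eq_mul] at e2
  exact e2.symm

theorem sq_eq (X : SLt F) : (X * X).1 0 0 = tr X * X.1 0 0 - 1 ∧ (X * X).1 0 1 = tr X * X.1 0 1 ∧
    (X * X).1 1 0 = tr X * X.1 1 0 ∧ (X * X).1 1 1 = tr X * X.1 1 1 - 1 := by
  have := det_eq X
  simp only [mul00, mul01, mul10, mul11, tr]
  refine ⟨?_, ?_, ?_, ?_⟩
  · linear_combination -this
  · ring
  · ring
  · linear_combination -this

theorem tr_invol {Z : SLt F} (hZ : ¬ Sc Z) (h : Sc (Z * Z)) : tr Z = 0 := by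
  obtain ⟨e1, e2, e3, e4⟩ := sq_eq Z
  obtain ⟨h1, h2, h3⟩ := h
  by_contra ht
  apply hZ
  rw [e2] at h1
  rw [e3] at h2
  rw [e1, e4] at h3
  refine ⟨?_, ?_, ?_⟩
  · exact (mul_eq_zero.mp h1).resolve_left ht
  · exact (mul_eq_zero.mp h2).resolve_left ht
  · apply mul_left_cancel₀ ht; linear_combination h3

theorem ax_S_sqrt {z w y : PSLt F} (hz : z ≠ 1) (hw : w ≠ 1) (hzz : z * z = 1) (hww : w * w = 1)
    (hy : y ∈ A z) (hyy : y * y = z) : ∃ y' ∈ A w, y' * y' = w := by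
  obtain ⟨Z, rfl⟩ := pr_surj z
  obtain ⟨W, rfl⟩ := pr_surj w
  obtain ⟨Y, rfl⟩ := pr_surj y
  rw [sc_iff_ne] at hz hw
  rw [← map_mul, pr_eq_one] at hzz hww
  rw [mem_A] at hy
  have tz := tr_invol hz hzz
  have tw := tr_invol hw hww
  obtain ⟨a, b, h1, h2, h3, h4⟩ := param hz hy
  have dY := det_eq Y
  have dZ := det_eq Z
  have dW := det_eq W
  have hab : a ^ 2 + b ^ 2 = 1 := by
    rw [h1, h2, h3, h4] at dY
    unfold tr at tz
    linear_combination dY - b ^ 2 * dZ - a * b * tz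
  have key : a ^ 2 = b ^ 2 ∧ (2 * (a * b) = 1 ∨ 2 * (a * b) = -1) := by
    rw [← map_mul] at hyy
    have e : ∀ e : F, (Y * Y).1 0 0 = e * Z.1 0 0 → (Y * Y).1 0 1 = e * Z.1 0 1 →
        (Y * Y).1 1 0 = e * Z.1 1 0 → (Y * Y).1 1 1 = e * Z.1 1 1 →
        a ^ 2 = b ^ 2 ∧ 2 * (a * b) = e := by
      intro e k1 k2 k3 k4
      simp only [mul00, mul01, mul10, mul11, h1, h2, h3, h4] at k1 k2 k3 k4
      unfold tr at tz
      have he : 2 * (a * b) = e := by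
        by_contra hne
        have hne' : 2 * (a * b) - e ≠ 0 := sub_ne_zero.mpr hne
        apply hz
        refine ⟨?_, ?_, ?_⟩ <;> apply mul_left_cancel₀ hne'
        · linear_combination k2 - b ^ 2 * Z.1 0 1 * tz
        · linear_combination k3 - b ^ 2 * Z.1 1 0 * tz
        · linear_combination k1 - k4 - b ^ 2 * (Z.1 0 0 - Z.1 1 1) * tz
      refine ⟨?_, he⟩
      have : Z.1 0 0 * Z.1 0 0 + Z.1 0 1 * Z.1 1 0 = -1 := by
        linear_combination Z.1 0 0 * tz - dZ
      linear_combination k1 - b ^ 2 * this - Z.1 0 0 * he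
    rcases pr_eq.mp hyy with h | h
    · have := e 1 (by rw [h]; ring) (by rw [h]; ring) (by rw [h]; ring) (by rw [h]; ring)
      exact ⟨this.1, Or.inl this.2⟩
    · have := e (-1) (by rw [h]; simp [ng]) (by rw [h]; simp [ng]) (by rw [h]; simp [ng])
        (by rw [h]; simp [ng])
      exact ⟨this.1, Or.inr this.2⟩
  have hd : (a + b * W.1 0 0) * (a + b * W.1 1 1) - (b * W.1 0 1) * (b * W.1 1 0) = 1 := by
    unfold tr at tw
    linear_combination hab + b ^ 2 * dW + a * b * tw
  unfold tr at tw
  have hWW : W.1 0 0 * W.1 0 0 + W.1 0 1 * W.1 1 0 = -1 := by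
    linear_combination W.1 0 0 * tw - dW
  have hWW' : W.1 1 1 * W.1 1 1 + W.1 0 1 * W.1 1 0 = -1 := by
    linear_combination W.1 1 1 * tw - dW
  refine ⟨pr (mat _ _ _ _ hd), ?_, ?_⟩
  · rw [mem_A]
    apply ext4 <;> simp <;> ring
  · rw [← map_mul, pr_eq]
    obtain ⟨k1, k2⟩ := key
    rcases k2 with k2 | k2
    · left
      apply ext4 <;> simp
      · linear_combination -k1 - W.1 0 0 * k2 - b ^ 2 * hWW
      · linear_combination - W.1 0 1 * k2 - b ^ 2 * W.1 0 1 * tw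
      · linear_combination - W.1 1 0 * k2 - b ^ 2 * W.1 1 0 * tw
      · linear_combination -k1 - W.1 1 1 * k2 - b ^ 2 * hWW'
    · right
      apply ext4 <;> simp [ng]
      · linear_combination k1 + W.1 0 0 * k2 + b ^ 2 * hWW
      · linear_combination W.1 0 1 * k2 + b ^ 2 * W.1 0 1 * tw
      · linear_combination W.1 1 0 * k2 + b ^ 2 * W.1 1 0 * tw
      · linear_combination k1 + W.1 1 1 * k2 + b ^ 2 * hWW'

theorem ax_U_cent {u g : PSLt F} (hS : ¬ S u) (h : g * u = u * g) : g ∈ A u := by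
  obtain ⟨U, rfl⟩ := pr_surj u
  obtain ⟨G, rfl⟩ := pr_surj g
  rw [S_pr, not_not] at hS
  rw [mem_A]
  rw [← map_mul, ← map_mul] at h
  rcases pr_eq.mp h with h | h
  · exact h
  · have h1 : G * (ng U) * G⁻¹ = U := by
      rw [mul_inv_eq_iff_eq_mul, mul_ng, h]
    have h2 : tr (ng U) = tr U := by
      rw [← tr_conj G (ng U), h1]
    have h3 : tr (ng U) = - tr U := by simp [tr, ng]; ring
    have h4 : 2 * tr U = 0 := by linear_combination h3 - h2
    have h5 : (2 : F) = 0 := by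
      rcases mul_eq_zero.mp h4 with h | h
      · exact h
      · rw [h] at hS
        have : (2 : F) * 2 = 0 := by linear_combination -hS
        exact mul_self_eq_zero.mp this
    rw [h]
    apply ext4 <;> simp [ng]
    · linear_combination (-(G.1 0 0 * U.1 0 0 + G.1 0 1 * U.1 1 0)) * h5
    · linear_combination (-(G.1 0 0 * U.1 0 1 + G.1 0 1 * U.1 1 1)) * h5
    · linear_combination (-(G.1 1 0 * U.1 0 0 + G.1 1 1 * U.1 1 0)) * h5
    · linear_combination (-(G.1 1 0 * U.1 0 1 + G.1 1 1 * U.1 1 1)) * h5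

end PSLtwo

namespace PSLtwo
variable {F : Type*} [Field F]

/-! ### Tori are cyclic -/

theorem torus_char {X : SLt F} (hX : ¬ Sc X) (hS : tr X ^ 2 ≠ 4) :
    ∃ f : Subgroup.centralizer {X} →* AlgebraicClosure F, Function.Injective f ∧
      ∀ Y, f Y ^ 2 - algebraMap F _ (tr Y.1) * f Y + 1 = 0 := by
  classical
  let K := AlgebraicClosure F
  let i := algebraMap F K
  obtain ⟨l, hl⟩ := Module.End.exists_eigenvalue (Matrix.toLin' (X.1.map i))
  obtain ⟨w, hw⟩ := hl.exists_hasEigenvector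
  have hw0 := hw.2
  have he := hw.apply_eq_smul
  have e0 : i (X.1 0 0) * w 0 + i (X.1 0 1) * w 1 = l * w 0 := by
    have := congrFun he 0
    simpa [Matrix.toLin'_apply, Matrix.mulVec, dotProduct, Fin.sum_univ_two] using this
  have e1 : i (X.1 1 0) * w 0 + i (X.1 1 1) * w 1 = l * w 1 := by
    have := congrFun he 1
    simpa [Matrix.toLin'_apply, Matrix.mulVec, dotProduct, Fin.sum_univ_two] using this
  have hne : w 0 ≠ 0 ∨ w 1 ≠ 0 := by
    by_contra h
    push Not at h
    apply hw0
    ext j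
    fin_cases j
    · exact h.1
    · exact h.2
  have hcan : ∀ c : K, c * w 0 = 0 → c * w 1 = 0 → c = 0 := by
    intro c h0 h1
    rcases hne with h | h
    · exact (mul_eq_zero.mp h0).resolve_right h
    · exact (mul_eq_zero.mp h1).resolve_right h
  have hex : ∀ Y : Subgroup.centralizer {X}, ∃ m : K,
      i (Y.1.1 0 0) * w 0 + i (Y.1.1 0 1) * w 1 = m * w 0 ∧
      i (Y.1.1 1 0) * w 0 + i (Y.1.1 1 1) * w 1 = m * w 1 := by
    intro Y
    have hY := Subgroup.mem_centralizer_singleton_iff.mp Y.2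
    obtain ⟨a, b, h1, h2, h3, h4⟩ := param hX hY.symm
    refine ⟨i a + i b * l, ?_, ?_⟩
    · rw [h1, h2]; simp only [map_add, map_mul]; linear_combination i b * e0
    · rw [h3, h4]; simp only [map_add, map_mul]; linear_combination i b * e1
  choose m hm0 hm1 using hex
  have huniq : ∀ (Y : Subgroup.centralizer {X}) (c : K),
      i (Y.1.1 0 0) * w 0 + i (Y.1.1 0 1) * w 1 = c * w 0 →
      i (Y.1.1 1 0) * w 0 + i (Y.1.1 1 1) * w 1 = c * w 1 → m Y = c := by
    intro Y c h0 h1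
    have := hcan (m Y - c) (by linear_combination h0 - hm0 Y) (by linear_combination h1 - hm1 Y)
    linear_combination this
  have hone : m 1 = 1 := by
    apply huniq <;> simp
  have hmul : ∀ Y Z, m (Y * Z) = m Y * m Z := by
    intro Y Z
    have y0 := hm0 Y
    have y1 := hm1 Y
    have z0 := hm0 Z
    have z1 := hm1 Z
    apply huniq
    · simp only [Subgroup.coe_mul, mul00, mul01, map_add, map_mul]
      linear_combination i (Y.1.1 0 0) * z0 + i (Y.1.1 0 1) * z1 + m Z * y0
    · simp only [Subgroup.coe_mul, mul10, mul11, map_add, map_mul]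
      linear_combination i (Y.1.1 1 0) * z0 + i (Y.1.1 1 1) * z1 + m Z * y1
  have hquad : ∀ Y, m Y ^ 2 - i (tr Y.1) * m Y + 1 = 0 := by
    intro Y
    have y0 := hm0 Y
    have y1 := hm1 Y
    have hd := congrArg i (det_eq Y.1)
    simp only [map_sub, map_mul, map_one] at hd
    apply hcan
    · simp only [tr, map_add]
      linear_combination -w 0 * hd + (i (Y.1.1 1 1) - m Y) * y0 - i (Y.1.1 0 1) * y1
    · simp only [tr, map_add]
      linear_combination -w 1 * hd + (i (Y.1.1 0 0) - m Y) * y1 - i (Y.1.1 1 0) * y0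
  let f : Subgroup.centralizer {X} →* K := { toFun := m, map_one' := hone, map_mul' := hmul }
  refine ⟨f, ?_, hquad⟩
  rw [injective_iff_map_eq_one]
  intro Y hY
  have hY1 : m Y = 1 := hY
  have q := hquad Y
  rw [hY1] at q
  have ht : tr Y.1 = 2 := by
    apply i.injective
    rw [map_ofNat]
    linear_combination -q
  have hc := Subgroup.mem_centralizer_singleton_iff.mp Y.2
  obtain ⟨a, b, h1, h2, h3, h4⟩ := param hX hc.symm
  have hd := disc_param h1 h2 h3 h4
  rw [ht] at hd
  have hb : b = 0 := by
    have : b ^ 2 * (tr X ^ 2 - 4) = 0 := by rw [← hd]; norm_num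
    rcases mul_eq_zero.mp this with h | h
    · exact pow_eq_zero_iff (by norm_num) |>.mp h
    · exact absurd (sub_eq_zero.mp h) hS
  subst hb
  have y0 := hm0 Y
  have y1 := hm1 Y
  rw [hY1] at y0 y1
  have ha : a = 1 := by
    have : i (a - 1) = 0 := by
      apply hcan
      · rw [h1, h2] at y0; simp only [zero_mul, map_zero, add_zero] at y0
        rw [map_sub, map_one]; linear_combination y0
      · rw [h3, h4] at y1; simp only [zero_mul, map_zero, zero_add, add_zero] at y1
        rw [map_sub, map_one]; linear_combination y1
    rw [map_eq_zero] at this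
    linear_combination this
  subst ha
  ext1
  apply ext4 <;> simp [h1, h2, h3, h4]

theorem A_pr_le {X : SLt F} {y : PSLt F} (hy : y ∈ A (pr X)) :
    ∃ Y : Subgroup.centralizer {X}, pr Y.1 = y := by
  obtain ⟨Y, rfl⟩ := pr_surj y
  rw [mem_A] at hy
  exact ⟨⟨Y, Subgroup.mem_centralizer_singleton_iff.mpr hy.symm⟩, rfl⟩

theorem ax_S_cyc [Finite F] {x : PSLt F} (hx : x ≠ 1) (hS : S x) : IsCyclic (A x) := by
  obtain ⟨X, rfl⟩ := pr_surj x
  rw [sc_iff_ne] at hx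
  rw [S_pr] at hS
  obtain ⟨f, hf, -⟩ := torus_char hx hS
  have := isCyclic_of_injective_ringHom f hf
  let g : Subgroup.centralizer {X} →* A (pr X) :=
    (pr.comp (Subgroup.subtype _)).codRestrict (A (pr X)) (by
      intro Y
      rw [MonoidHom.comp_apply, mem_A]
      exact (Subgroup.mem_centralizer_singleton_iff.mp Y.2).symm)
  apply isCyclic_of_surjective g
  rintro ⟨y, hy⟩
  obtain ⟨Y, rfl⟩ := A_pr_le hy
  exact ⟨Y, rfl⟩

theorem ax_card [Fintype F] {x : PSLt F} (hx : x ≠ 1) (hS : S x) :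
    (Even (Fintype.card F) → Nat.card (A x) ∣ Fintype.card F - 1 ∨
      Nat.card (A x) ∣ Fintype.card F + 1) ∧
    (Odd (Fintype.card F) → Nat.card (A x) ∣ (Fintype.card F - 1) / 2 ∨
      Nat.card (A x) ∣ (Fintype.card F + 1) / 2) := by
  have hcyc := ax_S_cyc hx hS
  obtain ⟨X, rfl⟩ := pr_surj x
  rw [sc_iff_ne] at hx
  rw [S_pr] at hS
  obtain ⟨f, hf, hq⟩ := torus_char hx hS
  obtain ⟨y, hy⟩ := IsCyclic.exists_ofOrder_eq_natCard (α := A (pr X))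
  obtain ⟨Y, hY⟩ := A_pr_le y.2
  rw [← hy, ← Subgroup.orderOf_coe, ← hY]
  set q := Fintype.card F with hqdef
  have hqpos : 1 < q := Fintype.one_lt_card
  have hmain : f Y ^ (q - 1) = 1 ∨ f Y ^ (q + 1) = 1 := by
    have h1 := hq Y
    have h2 := congrArg (FiniteField.frobeniusAlgHom F (AlgebraicClosure F)) h1
    simp only [map_add, map_sub, map_mul, map_pow, map_one, map_zero, AlgHom.commutes] at h2
    have h3 : FiniteField.frobeniusAlgHom F (AlgebraicClosure F) (f Y) = f Y ^ q := rfl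
    rw [h3] at h2
    have hne : f Y ≠ 0 := by
      intro h; rw [h] at h1; simp at h1
    have h4 : (f Y ^ q - f Y) * (f Y ^ q * f Y - 1) = 0 := by
      linear_combination f Y * h2 - f Y ^ q * h1
    rcases mul_eq_zero.mp h4 with h | h
    · left
      apply mul_right_cancel₀ hne
      rw [← pow_succ, Nat.sub_add_cancel hqpos.le, one_mul]
      linear_combination h
    · right
      rw [pow_succ]; linear_combination h
  constructor
  · intro _
    refine hmain.imp ?_ ?_ <;>
    · intro h
      apply orderOf_dvd_of_pow_eq_one
      rw [← map_pow]
      have : Y ^ _ = 1 := hf (by rw [map_pow, h, map_one])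
      have := congrArg (fun Z : Subgroup.centralizer {X} => pr Z.1) this
      simpa using this
  · intro hodd
    have key : ∀ k, f Y ^ (2 * k) = 1 → orderOf (pr Y.1) ∣ k := by
      intro k hk
      apply orderOf_dvd_of_pow_eq_one
      have hk' : (f Y ^ k - 1) * (f Y ^ k + 1) = 0 := by
        have : f Y ^ (2 * k) = f Y ^ k * f Y ^ k := by rw [two_mul, pow_add]
        rw [this] at hk
        linear_combination hk
      rcases mul_eq_zero.mp hk' with h | h
      · rw [← map_pow]
        have h' : Y ^ k = 1 := hf (by rw [map_pow, map_one]; linear_combination h)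
        have := congrArg (fun Z : Subgroup.centralizer {X} => pr Z.1) h'
        simpa using this
      · have h5 : f (Y ^ k) = -1 := by rw [map_pow]; linear_combination h
        let M : Subgroup.centralizer {X} := ⟨ng 1, Subgroup.mem_centralizer_singleton_iff.mpr
          (comm_of_sc sc_ng_one)⟩
        have h6 : f M = -1 := by
          have := hq M
          have e : tr M.1 = -2 := by simp [tr, M, ng]; norm_num
          rw [e] at this
          have h7 : (f M + 1) ^ 2 = 0 := by
            rw [map_neg, map_ofNat] at this
            linear_combination this
          have := pow_eq_zero_iff (by norm_num) |>.mp h7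
          linear_combination this
        have h8 : Y ^ k = M := hf (by rw [h5, h6])
        have := congrArg (fun Z : Subgroup.centralizer {X} => pr Z.1) h8
        simp only [Subgroup.coe_pow, map_pow] at this
        rw [this]
        exact pr_eq_one.mpr sc_ng_one
    obtain ⟨r, hr⟩ := hodd
    refine hmain.imp ?_ ?_ <;>
    · intro h
      apply key
      rw [← h]
      congr 1
      omega

end PSLtwo

namespace PSLtwo
variable {F : Type*} [Field F]

/-! ### Verification of the properties: unipotent part -/

/-- Upper unipotent matrices. -/
def nn (b : F) : SLt F := mat 1 b 0 1 (by ring)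
/-- Lower unipotent matrices. -/
def ll (c : F) : SLt F := mat 1 0 c 1 (by ring)

theorem nn_add (b c : F) : nn b * nn c = nn (b + c) := by
  apply ext4 <;> simp [nn]; ring

theorem nn_zero : nn (0 : F) = 1 := by
  apply ext4 <;> simp [nn]

theorem nn_inv (b : F) : (nn b)⁻¹ = nn (-b) := by
  apply ext4 <;> simp [nn]

theorem nn_ne {b : F} (hb : b ≠ 0) : ¬ Sc (nn b) := by
  rintro ⟨h, -, -⟩
  exact hb h

theorem nn_ne_one {b : F} (hb : b ≠ 0) : pr (nn b) ≠ 1 := sc_iff_ne.mpr (nn_ne hb)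

/-- Upper triangular matrices with equal diagonal are unipotent up to sign. -/
theorem pr_upper {Y : SLt F} (h1 : Y.1 1 0 = 0) (h2 : Y.1 0 0 = Y.1 1 1) : ∃ b, pr Y = pr (nn b) := by
  have hd := det_eq Y
  rw [h1, h2] at hd
  have : (Y.1 1 1 - 1) * (Y.1 1 1 + 1) = 0 := by linear_combination hd
  rcases mul_eq_zero.mp this with h | h
  · refine ⟨Y.1 0 1, ?_⟩
    congr 1
    apply ext4 <;> simp [nn, h1, h2] <;> linear_combination h
  · refine ⟨-Y.1 0 1, ?_⟩
    rw [← pr_ng Y]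
    congr 1
    apply ext4 <;> simp [nn, h1, h2, ng] <;> linear_combination -h

theorem mem_A_std {b : F} (hb : b ≠ 0) {y : PSLt F} :
    y ∈ A (pr (nn b)) ↔ ∃ c, y = pr (nn c) := by
  obtain ⟨Y, rfl⟩ := pr_surj y
  constructor
  · intro h
    rw [mem_A] at h
    obtain ⟨a, t, h1, h2, h3, h4⟩ := param (nn_ne hb) h
    exact pr_upper (by rw [h3]; simp [nn]) (by rw [h1, h4]; simp [nn])
  · rintro ⟨c, h⟩
    rw [h, mem_A, nn_add, nn_add, add_comm]

theorem norm_std {b : F} (hb : b ≠ 0) {G : SLt F} (h : pr G * pr (nn b) * (pr G)⁻¹ ∈ A (pr (nn b))) :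
    G.1 1 0 = 0 := by
  rw [← map_inv, ← map_mul, ← map_mul, mem_A] at h
  obtain ⟨a, t, h1, h2, h3, h4⟩ := param (nn_ne hb) h
  have : b * (G.1 1 0 * G.1 1 0) = 0 := by
    simp [nn] at h3
    linear_combination -h3
  rcases mul_eq_zero.mp this with h | h
  · exact absurd h hb
  · exact mul_self_eq_zero.mp h

theorem conj_std {G : SLt F} (h : G.1 1 0 = 0) (x : F) :
    G * nn x * G⁻¹ = nn (G.1 0 0 ^ 2 * x) := by
  have hd := det_eq G
  rw [h] at hd
  apply ext4 <;> simp [nn, h]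
  · linear_combination hd
  · ring
  · linear_combination hd

theorem norm_std' {b : F} (hb : b ≠ 0) {G : SLt F} (h : G.1 1 0 = 0) :
    pr G * pr (nn b) * (pr G)⁻¹ ∈ A (pr (nn b)) := by
  rw [← map_inv, ← map_mul, ← map_mul, conj_std h, mem_A_std hb]
  exact ⟨_, rfl⟩

/-- A lift of trace two. -/
theorem lift_two {u : PSLt F} (hS : ¬ S u) : ∃ X : SLt F, pr X = u ∧ tr X = 2 := by
  obtain ⟨X, rfl⟩ := pr_surj u
  rw [S_pr, not_not] at hS
  have : (tr X - 2) * (tr X + 2) = 0 := by linear_combination hS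
  rcases mul_eq_zero.mp this with h | h
  · exact ⟨X, rfl, by linear_combination h⟩
  · refine ⟨ng X, pr_ng X, ?_⟩
    have h3 : tr (ng X) = - tr X := by simp [tr, ng]; ring
    rw [h3]; linear_combination -h

theorem upper_two {X : SLt F} (ht : tr X = 2) (hc : X.1 1 0 = 0) : X = nn (X.1 0 1) := by
  have hd := det_eq X
  rw [hc] at hd
  unfold tr at ht
  have h0 : (X.1 0 0 - 1) ^ 2 = 0 := by linear_combination X.1 0 0 * ht - hd
  have h1 : X.1 0 0 = 1 := by
    have := pow_eq_zero_iff (two_ne_zero) |>.mp h0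
    linear_combination this
  apply ext4 <;> simp [nn, hc, h1]
  linear_combination ht - h1

/-- Every non-semisimple element is conjugate to a standard unipotent. -/
theorem std_form {u : PSLt F} (hu : u ≠ 1) (hS : ¬ S u) :
    ∃ (h : PSLt F) (b : F), b ≠ 0 ∧ u = h * pr (nn b) * h⁻¹ := by
  obtain ⟨X, rfl, ht⟩ := lift_two hS
  by_cases hc : X.1 1 0 = 0
  · have hX := upper_two ht hc
    refine ⟨1, X.1 0 1, ?_, by rw [← hX]; simp⟩
    intro hb
    rw [hb, nn_zero] at hX
    rw [hX, map_one] at hu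
    exact hu rfl
  · refine ⟨pr (mat (X.1 0 0 - 1) (-(X.1 1 0)⁻¹) (X.1 1 0) 0 (by field_simp; ring)), -(X.1 1 0)⁻¹,
      by simpa using hc, ?_⟩
    rw [← map_inv, ← map_mul, ← map_mul]
    congr 1
    have hd := det_eq X
    unfold tr at ht
    rw [eq_mul_inv_iff_mul_eq]
    apply ext4 <;> simp [nn] <;> field_simp
    · linear_combination (X.1 0 0) * ht - hd
    · ring
    · linear_combination ht

theorem mem_A_conj {u0 h y : PSLt F} : y ∈ A (h * u0 * h⁻¹) ↔ h⁻¹ * y * h ∈ A u0 := by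
  constructor
  · intro H
    have := ax_A_conj h⁻¹ H
    have e : h⁻¹ * (h * u0 * h⁻¹) * h⁻¹⁻¹ = u0 := by group
    rw [e, inv_inv] at this
    exact this
  · intro H
    have := ax_A_conj h H
    have e : h * (h⁻¹ * y * h) * h⁻¹ = y := by group
    rwa [e] at this

theorem norm_conj {u0 h g : PSLt F} :
    g * (h * u0 * h⁻¹) * g⁻¹ ∈ A (h * u0 * h⁻¹) ↔
      (h⁻¹ * g * h) * u0 * (h⁻¹ * g * h)⁻¹ ∈ A u0 := by
  rw [mem_A_conj]
  have e : h⁻¹ * (g * (h * u0 * h⁻¹) * g⁻¹) * h = (h⁻¹ * g * h) * u0 * (h⁻¹ * g * h)⁻¹ := by group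
  rw [e]

theorem ax_U_comm {u g k : PSLt F} (hu : u ≠ 1) (hS : ¬ S u) (hg : g * u * g⁻¹ ∈ A u)
    (hk : k * u * k⁻¹ ∈ A u) : g * k * g⁻¹ * k⁻¹ ∈ A u := by
  obtain ⟨h, b, hb, rfl⟩ := std_form hu hS
  rw [norm_conj] at hg hk
  rw [mem_A_conj]
  have e : h⁻¹ * (g * k * g⁻¹ * k⁻¹) * h = (h⁻¹ * g * h) * (h⁻¹ * k * h) * (h⁻¹ * g * h)⁻¹ *
    (h⁻¹ * k * h)⁻¹ := by group
  rw [e]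
  generalize h⁻¹ * g * h = g' at *
  generalize h⁻¹ * k * h = k' at *
  obtain ⟨G, rfl⟩ := pr_surj g'
  obtain ⟨K, rfl⟩ := pr_surj k'
  have h1 := norm_std hb hg
  have h2 := norm_std hb hk
  rw [mem_A_std hb, ← map_mul, ← map_inv, ← map_mul, ← map_inv, ← map_mul]
  apply pr_upper <;> simp [h1, h2]
  ring

theorem exists_sq_sub [Finite F] (c : F) : ∃ s t : F, c = s ^ 2 - t ^ 2 := by
  by_cases h : (2 : F) = 0
  · have : CharP F 2 := CharTwo.of_one_ne_zero_of_two_eq_zero one_ne_zero h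
    have := Fintype.ofFinite F
    obtain ⟨r, hr⟩ := FiniteField.isSquare_of_char_two (ringChar.eq F 2) c
    exact ⟨r, 0, by rw [hr]; ring⟩
  · refine ⟨(c + 1) / 2, (c - 1) / 2, ?_⟩
    field_simp
    ring

theorem U_simple_std [Finite F] {b : F} (hb : b ≠ 0) (H : Subgroup (PSLt F))
    (hH : H ≤ A (pr (nn b)))
    (hn : ∀ g, g * pr (nn b) * g⁻¹ ∈ A (pr (nn b)) → ∀ h ∈ H, g * h * g⁻¹ ∈ H) :
    H = ⊥ ∨ H = A (pr (nn b)) := by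
  by_cases hbot : H = ⊥
  · exact Or.inl hbot
  right
  apply le_antisymm hH
  obtain ⟨y, hy, hy1⟩ := (Subgroup.bot_or_exists_ne_one H).resolve_left hbot
  obtain ⟨c, rfl⟩ := (mem_A_std hb).mp (hH hy)
  have hc : c ≠ 0 := by
    rintro rfl
    rw [nn_zero, map_one] at hy1
    exact hy1 rfl
  have hsq : ∀ a : F, pr (nn (a ^ 2 * c)) ∈ H := by
    intro a
    by_cases ha : a = 0
    · rw [ha]; simp [nn_zero]
    · have hG := hn (pr (mat a 0 0 a⁻¹ (by field_simp; ring))) (norm_std' hb (by simp)) _ hy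
      rw [← map_inv, ← map_mul, ← map_mul, conj_std (by simp)] at hG
      simpa using hG
  intro z hz
  obtain ⟨x, rfl⟩ := (mem_A_std hb).mp hz
  obtain ⟨s, t, hst⟩ := exists_sq_sub (x / c)
  have e : nn x = nn (s ^ 2 * c) * (nn (t ^ 2 * c))⁻¹ := by
    rw [nn_inv, nn_add]
    congr 1
    rw [div_eq_iff hc] at hst
    rw [hst]; ring
  rw [e, map_mul, map_inv]
  exact H.mul_mem (hsq s) (H.inv_mem (hsq t))

theorem ax_U_simple [Finite F] {u : PSLt F} (hu : u ≠ 1) (hS : ¬ S u) (H : Subgroup (PSLt F))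
    (hH : H ≤ A u) (hn : ∀ g, g * u * g⁻¹ ∈ A u → ∀ h ∈ H, g * h * g⁻¹ ∈ H) :
    H = ⊥ ∨ H = A u := by
  obtain ⟨k, b, hb, rfl⟩ := std_form hu hS
  have key := U_simple_std hb (H.conjugate k) ?_ ?_
  · rcases key with h | h
    · left
      rw [Subgroup.eq_bot_iff_forall] at h ⊢
      intro x hx
      have := h (k⁻¹ * x * k) (by
        rw [mem_conjugate]
        have e : k * (k⁻¹ * x * k) * k⁻¹ = x := by group
        rwa [e])
      have e : x = k * (k⁻¹ * x * k) * k⁻¹ := by group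
      rw [e, this]; group
    · right
      ext x
      rw [mem_A_conj, ← h, mem_conjugate]
      have e : k * (k⁻¹ * x * k) * k⁻¹ = x := by group
      rw [e]
  · intro y hy
    rw [mem_conjugate] at hy
    have := hH hy
    rw [mem_A_conj] at this
    have e : k⁻¹ * (k * y * k⁻¹) * k = y := by group
    rwa [e] at this
  · intro g hg h hh
    rw [mem_conjugate] at hh ⊢
    have := hn (k * g * k⁻¹) (by
      rw [norm_conj]
      have e : k⁻¹ * (k * g * k⁻¹) * k = g := by group
      rwa [e]) _ hh
    have e : k * g * k⁻¹ * (k * h * k⁻¹) * (k * g * k⁻¹)⁻¹ = k * (g * h * g⁻¹) * k⁻¹ := by group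
    rwa [e] at this

/-- The field condition needed for fullness. -/
def Irr (F : Type*) [Field F] : Prop := ∀ a : F, a ≠ 0 → a ^ 2 ≠ 1 → ∀ E : AddSubgroup F,
  (∀ x ∈ E, a ^ 2 * x ∈ E) → E = ⊥ ∨ E = ⊤

theorem U_full_std (hI : Irr F) {b : F} (hb : b ≠ 0) (J : Subgroup (PSLt F)) {g : PSLt F}
    (hu : pr (nn b) ∈ J) (hg : g ∈ J) (hgn : g * pr (nn b) * g⁻¹ ∈ A (pr (nn b)))
    (hgA : g ∉ A (pr (nn b))) : A (pr (nn b)) ≤ J := by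
  obtain ⟨G, rfl⟩ := pr_surj g
  have hG := norm_std hb hgn
  have hd := det_eq G
  rw [hG] at hd
  have ha : G.1 0 0 ≠ 0 := by
    intro h
    rw [h] at hd
    simp at hd
  have ha2 : G.1 0 0 ^ 2 ≠ 1 := by
    intro h
    apply hgA
    rw [mem_A_std hb]
    apply pr_upper hG
    apply mul_left_cancel₀ ha
    linear_combination h - hd
  let E : AddSubgroup F :=
    { carrier := {x | pr (nn x) ∈ J}
      zero_mem' := by
        show pr (nn 0) ∈ J
        rw [nn_zero, map_one]; exact J.one_mem
      add_mem' := by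
        intro x y hx hy
        show pr (nn (x + y)) ∈ J
        rw [← nn_add, map_mul]
        exact J.mul_mem hx hy
      neg_mem' := by
        intro x hx
        show pr (nn (-x)) ∈ J
        rw [← nn_inv, map_inv]
        exact J.inv_mem hx }
  have hE : ∀ x, x ∈ E ↔ pr (nn x) ∈ J := fun x => Iff.rfl
  rcases hI _ ha ha2 E (fun x hx => by
    rw [hE] at hx ⊢
    rw [← conj_std hG, map_mul, map_mul, map_inv]
    exact J.mul_mem (J.mul_mem hg hx) (J.inv_mem hg)) with h | h
  · exfalso
    have : b ∈ E := hu
    rw [h, AddSubgroup.mem_bot] at this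
    exact hb this
  · intro y hy
    obtain ⟨c, rfl⟩ := (mem_A_std hb).mp hy
    have : c ∈ E := by rw [h]; trivial
    exact this

theorem ax_U_full (hI : Irr F) (J : Subgroup (PSLt F)) {u g : PSLt F} (hu1 : u ≠ 1) (hS : ¬ S u)
    (hu : u ∈ J) (hg : g ∈ J) (hgn : g * u * g⁻¹ ∈ A u) (hgA : g ∉ A u) : A u ≤ J := by
  obtain ⟨k, b, hb, rfl⟩ := std_form hu1 hS
  rw [norm_conj] at hgn
  rw [mem_A_conj] at hgA
  have key := U_full_std hI hb (J.conjugate k) (mem_conjugate.mpr hu) (mem_conjugate.mpr (by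
    have e : k * (k⁻¹ * g * k) * k⁻¹ = g := by group
    rwa [e])) hgn hgA
  intro y hy
  have := mem_conjugate.mp (key (mem_A_conj.mp hy))
  have e : k * (k⁻¹ * y * k) * k⁻¹ = y := by group
  rwa [e] at this

theorem gen_SL (L : Subgroup (SLt F)) (h1 : ∀ b, nn b ∈ L) (h2 : ∀ c, ll c ∈ L) : L = ⊤ := by
  have key : ∀ X : SLt F, X.1 1 0 ≠ 0 → X ∈ L := by
    intro X hc
    have hd := det_eq X
    have : X = nn ((X.1 0 0 - 1) / X.1 1 0) * ll (X.1 1 0) * nn ((X.1 1 1 - 1) / X.1 1 0) := by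
      apply ext4 <;> simp [nn, ll] <;> field_simp
      · ring
      · linear_combination -hd
      · ring
    rw [this]
    exact L.mul_mem (L.mul_mem (h1 _) (h2 _)) (h1 _)
  rw [eq_top_iff]
  intro X _
  by_cases hc : X.1 1 0 = 0
  · have hd := det_eq X
    rw [hc] at hd
    have : ll 1 * X ∈ L := by
      apply key
      simp [ll, hc]
      intro h
      rw [h] at hd
      simp at hd
    have h3 := L.mul_mem (L.inv_mem (h2 1)) this
    rwa [inv_mul_cancel_left] at h3
  · exact key X hc

theorem U_gen_std {b : F} (hb : b ≠ 0) (L : Subgroup (PSLt F)) {v : PSLt F} (hv : v ≠ 1)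
    (hS : ¬ S v) (hne : A (pr (nn b)) ≠ A v) (h1 : A (pr (nn b)) ≤ L) (h2 : A v ≤ L) : L = ⊤ := by
  obtain ⟨V, rfl, ht⟩ := lift_two hS
  have hc : V.1 1 0 ≠ 0 := by
    intro hc
    have hV := upper_two ht hc
    apply hne
    refine (ax_A_eq (nn_ne_one hb) ?_ hv).symm
    rw [mem_A_std hb]
    exact ⟨_, congrArg pr hV⟩
  have hn : ∀ x, pr (nn x) ∈ L := fun x => h1 ((mem_A_std hb).mpr ⟨x, rfl⟩)
  have hd := det_eq V
  unfold tr at ht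
  obtain ⟨s, hs⟩ : ∃ s, s = (1 - V.1 0 0) / V.1 1 0 := ⟨_, rfl⟩
  rw [eq_div_iff hc] at hs
  have hV : V = nn (-s) * ll (V.1 1 0) * (nn (-s))⁻¹ := by
    rw [eq_mul_inv_iff_mul_eq]
    apply ext4 <;> simp [nn, ll]
    · linear_combination hs
    · apply mul_left_cancel₀ hc
      linear_combination -hd - V.1 0 0 * hs + V.1 0 0 * ht + hs
    · linear_combination ht - hs
  have hl : ∀ x, pr (ll x) ∈ L := by
    intro x
    have hx : pr (nn (-s) * ll x * (nn (-s))⁻¹) ∈ L := by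
      apply h2
      rw [mem_A]
      have := conj_comm (G := nn (-s)) (X := ll (V.1 1 0)) (Y := ll x) (by
        apply ext4 <;> simp [ll]; ring)
      rw [← hV] at this
      exact this
    have h3 := L.mul_mem (L.mul_mem (L.inv_mem (hn (-s))) hx) (hn (-s))
    rw [← map_inv, ← map_mul, ← map_mul] at h3
    have e : (nn (-s))⁻¹ * (nn (-s) * ll x * (nn (-s))⁻¹) * nn (-s) = ll x := by group
    rwa [e] at h3
  have htop := gen_SL (L.comap pr) hn hl
  rw [eq_top_iff]
  intro y _
  obtain ⟨Y, rfl⟩ := pr_surj y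
  have : Y ∈ L.comap pr := by rw [htop]; trivial
  exact this

theorem ax_U_gen (L : Subgroup (PSLt F)) {u v : PSLt F} (hu : u ≠ 1) (hSu : ¬ S u) (hv : v ≠ 1)
    (hSv : ¬ S v) (hne : A u ≠ A v) (h1 : A u ≤ L) (h2 : A v ≤ L) : L = ⊤ := by
  obtain ⟨k, b, hb, rfl⟩ := std_form hu hSu
  have hv0 : v = k * (k⁻¹ * v * k) * k⁻¹ := by group
  generalize k⁻¹ * v * k = w at hv0
  subst hv0
  have key := U_gen_std hb (L.conjugate k) (v := w) (by rintro rfl; simp at hv)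
    (fun h => hSv (ax_S_conj k h)) ?_ ?_ ?_
  · rw [eq_top_iff]
    intro y _
    have : k⁻¹ * y * k ∈ L.conjugate k := by rw [key]; trivial
    rw [mem_conjugate] at this
    have e : k * (k⁻¹ * y * k) * k⁻¹ = y := by group
    rwa [e] at this
  · intro h
    apply hne
    ext y
    rw [mem_A_conj, mem_A_conj, h]
  · intro y hy
    rw [mem_conjugate]
    exact h1 (ax_A_conj k hy)
  · intro y hy
    rw [mem_conjugate]
    exact h2 (ax_A_conj k hy)

/-! ### The field condition -/

theorem irr_prime [Fintype F] (h : (Fintype.card F).Prime) : Irr F := by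
  intro a _ _ E _
  have : Fact (Nat.card F).Prime := ⟨by rwa [Nat.card_eq_fintype_card]⟩
  exact AddSubgroup.eq_bot_or_eq_top_of_prime_card E

theorem irr_pow [Fintype F] {p n : ℕ} (hp : p.Prime) (hn : n.Prime) (h : Fintype.card F = p ^ n)
    (hno : ∀ a : F, a ≠ 0 → a ^ 2 ≠ 1 → (a ^ 2) ^ p ≠ a ^ 2) : Irr F := by
  classical
  intro a ha ha1 E hE
  let R : Subring F :=
    { carrier := {c | ∀ x ∈ E, c * x ∈ E}
      one_mem' := fun x hx => by rwa [one_mul]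
      zero_mem' := fun x hx => by rw [zero_mul]; exact E.zero_mem
      mul_mem' := fun {c d} hc hd x hx => by rw [mul_assoc]; exact hc _ (hd _ hx)
      add_mem' := fun {c d} hc hd x hx => by rw [add_mul]; exact E.add_mem (hc _ hx) (hd _ hx)
      neg_mem' := fun {c} hc x hx => by rw [neg_mul]; exact E.neg_mem (hc _ hx) }
  have hR : ∀ c, c ∈ R ↔ ∀ x ∈ E, c * x ∈ E := fun c => Iff.rfl
  have : Fintype R := Fintype.ofFinite R
  let _ : Field R := Fintype.fieldOfDomain R
  have hcard := Module.card_eq_pow_finrank (K := R) (V := F)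
  set m := Module.finrank R F
  rw [h] at hcard
  have hm : m ≠ 0 := by
    intro h0
    rw [h0, pow_zero] at hcard
    exact absurd hcard (Nat.one_lt_pow hn.ne_zero hp.one_lt).ne'
  obtain ⟨k, hk, hk'⟩ := (Nat.dvd_prime_pow hp).mp (hcard ▸ dvd_pow_self (Fintype.card R) hm)
  rw [hk', ← pow_mul] at hcard
  have hkm := Nat.pow_right_injective hp.two_le hcard
  have hkn : k ∣ n := ⟨m, hkm⟩
  rcases (Nat.dvd_prime hn).mp hkn with h1 | h1
  · exfalso
    rw [h1, pow_one] at hk'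
    have h3 := FiniteField.pow_card (⟨a ^ 2, hE⟩ : R)
    rw [hk'] at h3
    exact hno a ha ha1 (congrArg Subtype.val h3)
  · have htop : ∀ c : F, c ∈ R := by
      have : Function.Bijective (Subtype.val : R → F) := by
        rw [Fintype.bijective_iff_injective_and_card]
        exact ⟨Subtype.val_injective, by rw [hk', h, h1]⟩
      intro c
      obtain ⟨y, rfl⟩ := this.2 c
      exact y.2
    by_cases hb : E = ⊥
    · exact Or.inl hb
    · right
      obtain ⟨x, hx, hx0⟩ := (AddSubgroup.bot_or_exists_ne_zero E).resolve_left hb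
      rw [eq_top_iff]
      intro y _
      have := (hR _).mp (htop (y / x)) x hx
      rwa [div_mul_cancel₀ _ hx0] at this

theorem irr_two [Fintype F] {n : ℕ} (hn : n.Prime) (h : Fintype.card F = 2 ^ n) : Irr F := by
  refine irr_pow Nat.prime_two hn h ?_
  intro a ha ha1 h2
  apply ha1
  apply mul_left_cancel₀ (pow_ne_zero 2 ha)
  linear_combination h2

theorem pow_three_mod {n : ℕ} (hn : Odd n) : 3 ^ n % 8 = 3 := by
  obtain ⟨k, rfl⟩ := hn
  rw [pow_succ, pow_mul, Nat.mul_mod, Nat.pow_mod]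
  simp

theorem irr_three [Fintype F] {n : ℕ} (hn : n.Prime) (ho : Odd n) (h : Fintype.card F = 3 ^ n) :
    Irr F := by
  refine irr_pow Nat.prime_three hn h ?_
  intro a ha ha1 h2
  have h0 : a ^ 2 ≠ 0 := pow_ne_zero 2 ha
  have h3 : a ^ 2 * ((a ^ 2 - 1) * (a ^ 2 + 1)) = 0 := by linear_combination h2
  have h4 := ((mul_eq_zero.mp h3).resolve_left h0)
  have h5 := (mul_eq_zero.mp h4).resolve_left (sub_ne_zero.mpr ha1)
  have hsq : IsSquare (-1 : F) := ⟨a, by linear_combination -h5⟩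
  rw [FiniteField.isSquare_neg_one_iff, h] at hsq
  have := pow_three_mod ho
  omega

end PSLtwo

namespace PSLtwo

/-! ### Numerical conditions and the final theorem -/

theorem pow_of_dvd {c m : ℕ} (h : c ∣ 2 ^ m) : ∃ k, c = 2 ^ k := by
  obtain ⟨k, -, hk⟩ := (Nat.dvd_prime_pow Nat.prime_two).mp h
  exact ⟨k, hk⟩

/-- Divisors of an integer not divisible by four, or of a power of two. -/
theorem good_of_dvd {c r : ℕ} (h : c ∣ r) (hr : ¬ 4 ∣ r ∨ ∃ m, r = 2 ^ m) :
    ¬ 4 ∣ c ∨ ∃ k, c = 2 ^ k := by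
  rcases hr with hr | ⟨m, rfl⟩
  · exact Or.inl fun h4 => hr (h4.trans h)
  · exact Or.inr (pow_of_dvd h)

theorem half_pow {r m : ℕ} (h : r = 2 ^ m) (hr : 2 ≤ r) : ∃ k, r / 2 = 2 ^ k := by
  cases m with
  | zero => rw [pow_zero] at h; omega
  | succ k => exact ⟨k, by rw [h, pow_succ]; omega⟩

theorem num_odd {q c : ℕ} (h2 : ¬ 4 ∣ (q - 1) / 2 ∨ ∃ m, (q - 1) / 2 = 2 ^ m)
    (h3 : ¬ 4 ∣ (q + 1) / 2 ∨ ∃ m, (q + 1) / 2 = 2 ^ m) (ho : Odd q)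
    (hc : Odd q → c ∣ (q - 1) / 2 ∨ c ∣ (q + 1) / 2) : ¬ 4 ∣ c ∨ ∃ k, c = 2 ^ k := by
  rcases hc ho with h | h
  · exact good_of_dvd h h2
  · exact good_of_dvd h h3

theorem two_pow_mod (m : ℕ) : 2 ^ m = 1 ∨ 2 ^ m = 2 ∨ 2 ^ m = 4 ∨ 8 ∣ 2 ^ m := by
  rcases m with _ | _ | _ | m
  · simp
  · simp
  · simp
  · right; right; right
    exact ⟨2 ^ m, by ring⟩

theorem num_card {p n q c : ℕ} (hq : q = p ^ n)
    (hcases :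
      (p = 2 ∧ n.Prime) ∨
      (p = 3 ∧ n.Prime ∧ Odd n) ∨
      (n = 1 ∧ q.Prime ∧ (q % 8 = 3 ∨ q % 8 = 5) ∧ 17 < q) ∨
      (q = 7 ∨ q = 17) ∨
      (n = 1 ∧ q.Prime ∧ (q % 8 = 1 ∨ q % 8 = 7) ∧
        ((∃ m : ℕ, q - 1 = 2 ^ m) ∨ (∃ m : ℕ, q + 1 = 2 ^ m))))
    (hc : (Even q → c ∣ q - 1 ∨ c ∣ q + 1) ∧ (Odd q → c ∣ (q - 1) / 2 ∨ c ∣ (q + 1) / 2)) :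
    ¬ 4 ∣ c ∨ ∃ k, c = 2 ^ k := by
  have key : (q % 8 = 3 ∨ q % 8 = 5) → ¬ 4 ∣ c ∨ ∃ k, c = 2 ^ k := by
    intro h
    exact num_odd (Or.inl (by omega)) (Or.inl (by omega)) (Nat.odd_iff.mpr (by omega)) hc.2
  rcases hcases with ⟨rfl, hn⟩ | ⟨rfl, -, ho⟩ | ⟨-, -, h, -⟩ | h | ⟨-, hpr, h, h'⟩
  · have he : Even q := by
      rw [hq]; exact (Nat.even_pow.mpr ⟨even_two, hn.ne_zero⟩)
    have h0 : q ≠ 0 := by rw [hq]; positivity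
    have he' := Nat.even_iff.mp he
    rcases hc.1 he with h | h
    · exact good_of_dvd h (Or.inl (by omega))
    · exact good_of_dvd h (Or.inl (by omega))
  · exact key (Or.inl (by rw [hq]; exact pow_three_mod ho))
  · exact key h
  · rcases h with h | h
    · exact num_odd (Or.inl (by omega)) (Or.inr ⟨2, by omega⟩) (Nat.odd_iff.mpr (by omega)) hc.2
    · exact num_odd (Or.inr ⟨3, by omega⟩) (Or.inl (by omega)) (Nat.odd_iff.mpr (by omega)) hc.2
  · have h2 := hpr.two_le
    have ho : Odd q := Nat.odd_iff.mpr (by omega)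
    rcases h' with ⟨m, hm⟩ | ⟨m, hm⟩
    · refine num_odd (Or.inr (half_pow hm (by omega))) (Or.inl ?_) ho hc.2
      have := two_pow_mod m
      omega
    · refine num_odd (Or.inl ?_) (Or.inr (half_pow hm (by omega))) ho hc.2
      have := two_pow_mod m
      omega

theorem irr_cases {p n q : ℕ} (hq : q = p ^ n)
    (hcases :
      (p = 2 ∧ n.Prime) ∨
      (p = 3 ∧ n.Prime ∧ Odd n) ∨
      (n = 1 ∧ q.Prime ∧ (q % 8 = 3 ∨ q % 8 = 5) ∧ 17 < q) ∨
      (q = 7 ∨ q = 17) ∨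
      (n = 1 ∧ q.Prime ∧ (q % 8 = 1 ∨ q % 8 = 7) ∧
        ((∃ m : ℕ, q - 1 = 2 ^ m) ∨ (∃ m : ℕ, q + 1 = 2 ^ m))))
    (F : Type*) [Field F] [Fintype F] (hF : Fintype.card F = q) : Irr F := by
  rcases hcases with ⟨rfl, hn⟩ | ⟨rfl, hn, ho⟩ | ⟨-, hpr, -⟩ | h | ⟨-, hpr, -⟩
  · exact irr_two hn (hF.trans hq)
  · exact irr_three hn ho (hF.trans hq)
  · exact irr_prime (hF ▸ hpr)
  · apply irr_prime
    rcases h with h | h <;> rw [hF, h] <;> norm_num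
  · exact irr_prime (hF ▸ hpr)

/-- The partition data of `PSL(2,q)`. -/
noncomputable def data (F : Type*) [Field F] [Finite F] (hI : Irr F)
    (hc : ∀ {x : PSLt F}, x ≠ 1 → S x → ¬ 4 ∣ Nat.card (A x) ∨ ∃ k, Nat.card (A x) = 2 ^ k) :
    PartData (PSLt F) where
  A := A
  S := S
  mem_self := ax_mem_self
  A_eq := ax_A_eq
  A_conj := ax_A_conj
  A_comm := ax_A_comm
  S_of_mem := ax_S_of_mem
  S_conj := ax_S_conj
  S_cyc := ax_S_cyc
  S_inv := ax_S_inv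
  S_mul := ax_S_mul
  S_card := hc
  S_sqrt := fun hz hw hzz hww _ _ hy hyy => ax_S_sqrt hz hw hzz hww hy hyy
  U_simple := fun hu hS H hH hn => ax_U_simple hu hS H hH hn
  U_comm := ax_U_comm
  U_full := fun J h1 h2 h3 h4 h5 h6 => ax_U_full hI J h1 h2 h3 h4 h5 h6
  U_gen := fun L h1 h2 h3 h4 h5 h6 h7 => ax_U_gen L h1 h2 h3 h4 h5 h6 h7
  U_cent := fun _ hS h => ax_U_cent hS h

end PSLtwo

theorem stmt6 (p n q : ℕ) (hp : p.Prime) (hq : q = p ^ n)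
    (hcases :
      (p = 2 ∧ n.Prime) ∨
      (p = 3 ∧ n.Prime ∧ Odd n) ∨
      (n = 1 ∧ q.Prime ∧ (q % 8 = 3 ∨ q % 8 = 5) ∧ 17 < q) ∨
      (q = 7 ∨ q = 17) ∨
      (n = 1 ∧ q.Prime ∧ (q % 8 = 1 ∨ q % 8 = 7) ∧
        ((∃ m : ℕ, q - 1 = 2 ^ m) ∨ (∃ m : ℕ, q + 1 = 2 ^ m))))
    (F : Type*) [Field F] [Fintype F] (hF : Fintype.card F = q)
    (H K : Subgroup (Matrix.ProjectiveSpecialLinearGroup (Fin 2) F))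
    (hH : IsPronormal H) (hK : IsPronormal K) :
    IsPronormal (H ⊔ K) := by
  have hfin : Finite (Matrix.ProjectiveSpecialLinearGroup (Fin 2) F) :=
    Finite.of_surjective _ (PSLtwo.pr_surj (F := F))
  refine PartData.main (PSLtwo.data F (PSLtwo.irr_cases hq hcases F hF) ?_) hH hK
  intro x hx hS
  have h := PSLtwo.ax_card hx hS
  rw [hF] at h
  exact PSLtwo.num_card hq hcases h
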